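/- For every type-B composition α of n, the lattice Tam_B(α) is trim: its number of join-irreducible elements, its number of meet-irreducible elements, and its length ℓ (the maximal m such that there is a chain x₀ < x₁ < ⋯ < x_m in Tam_B(α)) all coincide, and Tam_B(α) possesses a chain of ℓ+1 elements each of which is left modular (an element x is left modular if (r ∨ x) ∧ q = r ∨ (x ∧ q) for all r ≤ q). -/

import Mathlib

namespace TypeB

/-- A sign-symmetric permutation of degree `n`: a bijection of `ℤ` with
`π(-i) = -π(i)` which fixes every integer of absolute value `> n`.
It restricts to a sign-symmetric permutation of `±[n]`. -/
structure SignedPerm (n : ℕ) where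
  perm : Equiv.Perm ℤ
  sign_symm : ∀ i : ℤ, perm (-i) = - perm i
  outside : ∀ i : ℤ, (n : ℤ) < |i| → perm i = i

/-- Symbols for type-B inversions: `neg i` is `[i]`, `pair i j` (with `i < j`)
is `(i,j)`, and `mixed i j` (with `i < j`) is `(−j, i)`. -/
inductive BInv (n : ℕ) : Type where
  | neg : ℕ → BInv n
  | pair : ℕ → ℕ → BInv n
  | mixed : ℕ → ℕ → BInv n
deriving DecidableEq

/-- `i⁺`: `i+1` if `i ≠ -1`, and `1` for `i = -1`. -/
def iplus (i : ℤ) : ℤ := if i = -1 then 1 else i + 1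

/-- The inversion set of a sign-symmetric permutation. -/
def Inv {n : ℕ} (π : SignedPerm n) : Set (BInv n) := fun t =>
  match t with
  | .neg i => 1 ≤ i ∧ i ≤ n ∧ π.perm (i : ℤ) < 0
  | .pair i j => 1 ≤ i ∧ i < j ∧ j ≤ n ∧ π.perm (j : ℤ) < π.perm (i : ℤ)
  | .mixed i j => 1 ≤ i ∧ i < j ∧ j ≤ n ∧ π.perm (i : ℤ) + π.perm (j : ℤ) < 0

/-- The cover-inversion set of a sign-symmetric permutation. -/
def Cov {n : ℕ} (π : SignedPerm n) : Set (BInv n) := fun t =>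
  match t with
  | .neg i => 1 ≤ i ∧ i ≤ n ∧ π.perm (i : ℤ) = -1
  | .pair i j => 1 ≤ i ∧ i < j ∧ j ≤ n ∧ π.perm (i : ℤ) = iplus (π.perm (j : ℤ))
  | .mixed i j => 1 ≤ i ∧ i < j ∧ j ≤ n ∧ π.perm (-(j : ℤ)) = iplus (π.perm (i : ℤ))

/-- The symbol `(−j, i)` in canonical form (it equals `(−i, j)`). -/
def mixedInv {n : ℕ} (i j : ℕ) : BInv n := .mixed (min i j) (max i j)

/-- A type-B composition of `n`: positive parts summing to `n`,
together with a split/join label. -/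
structure BComp (n : ℕ) where
  parts : List ℕ
  pos : ∀ a ∈ parts, 0 < a
  sum_eq : parts.sum = n
  isJoin : Bool

/-- The partial sum `p_i = α₁ + ⋯ + α_i`. -/
def pSum {n : ℕ} (α : BComp n) (i : ℕ) : ℕ := (α.parts.take i).sum

/-- The α-region of `a ∈ [n]`: the unique `i` with `p_{i-1} < a ≤ p_i`. -/
def region {n : ℕ} (α : BComp n) (a : ℕ) : ℕ :=
  ((Finset.range α.parts.length).filter (fun j => pSum α j < a)).card

/-- The first part `α₁` of a type-B composition. -/
def alpha1 {n : ℕ} (α : BComp n) : ℕ := α.parts.headI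

/-- Index of the block of `Part(α)` containing `x ∈ ±[n]`; two elements lie in
a common block of `Part(α)` iff their indices agree. -/
def blockIdx {n : ℕ} (α : BComp n) (x : ℤ) : ℤ :=
  if 0 < x then
    (if α.isJoin = true ∧ region α x.toNat = 1 then 0 else (region α x.toNat : ℤ))
  else
    (if α.isJoin = true ∧ region α (-x).toNat = 1 then 0 else -(region α (-x).toNat : ℤ))

/-- Membership in `±[n]`. -/
def inPM (n : ℕ) (x : ℤ) : Prop := x ≠ 0 ∧ -(n : ℤ) ≤ x ∧ x ≤ (n : ℤ)

/-- `π ∈ H_α`: `π` is increasing on every block of `Part(α)`. -/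
def memH {n : ℕ} (α : BComp n) (π : SignedPerm n) : Prop :=
  ∀ a b : ℤ, inPM n a → inPM n b → a < b → blockIdx α a = blockIdx α b →
    π.perm a < π.perm b

/-- Common part of the type-B `(α,231)`- and `(α,312)`-patterns: indices
`i < j < k` in `±[n]`, in pairwise distinct blocks of `Part(α)`, with `j > 0`
and `π(i) = π(k)⁺`. -/
def patternCore {n : ℕ} (α : BComp n) (π : SignedPerm n) (i j k : ℤ) : Prop :=
  inPM n i ∧ inPM n j ∧ inPM n k ∧ i < j ∧ j < k ∧ 0 < j ∧
  blockIdx α i ≠ blockIdx α j ∧ blockIdx α j ≠ blockIdx α k ∧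
  blockIdx α i ≠ blockIdx α k ∧ π.perm i = iplus (π.perm k)

/-- `π` has a type-B `(α,231)`-split (resp. -join) pattern, according to the
label of `α`. -/
def has231 {n : ℕ} (α : BComp n) (π : SignedPerm n) : Prop :=
  ∃ i j k : ℤ, patternCore α π i j k ∧
    (if α.isJoin = true then
       (((alpha1 α : ℤ) < j → π.perm i < π.perm j) ∧
        (j ≤ (alpha1 α : ℤ) → π.perm j < π.perm k))
     else π.perm i < π.perm j)

/-- `π` has a type-B `(α,312)`-split (resp. -join) pattern, according to the
label of `α`. -/
def has312 {n : ℕ} (α : BComp n) (π : SignedPerm n) : Prop :=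
  ∃ i j k : ℤ, patternCore α π i j k ∧
    (if α.isJoin = true then
       (((alpha1 α : ℤ) < j → π.perm j < π.perm k) ∧
        (j ≤ (alpha1 α : ℤ) → π.perm i < π.perm j))
     else π.perm j < π.perm k)

/-- `π ∈ H_α(231)`. -/
def mem231 {n : ℕ} (α : BComp n) (π : SignedPerm n) : Prop := memH α π ∧ ¬ has231 α π

/-- `π ∈ H_α(312)`. -/
def mem312 {n : ℕ} (α : BComp n) (π : SignedPerm n) : Prop := memH α π ∧ ¬ has312 α π

/-- The set `H_α`. -/
def Hset {n : ℕ} (α : BComp n) : Set (SignedPerm n) := {π | memH α π}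

/-- The carrier of `Tam_B(α)`, namely `H_α(231)`. -/
def Tset {n : ℕ} (α : BComp n) : Set (SignedPerm n) := {π | mem231 α π}

/-- The weak order: inclusion of inversion sets. -/
def wle {n : ℕ} (π σ : SignedPerm n) : Prop := Inv π ⊆ Inv σ

/-- `m` is the greatest lower bound of `x` and `y` within `P`, w.r.t. the weak order. -/
def isMeetIn {n : ℕ} (P : Set (SignedPerm n)) (x y m : SignedPerm n) : Prop :=
  m ∈ P ∧ wle m x ∧ wle m y ∧ ∀ z ∈ P, wle z x → wle z y → wle z m

/-- `u` is the least upper bound of `x` and `y` within `P`, w.r.t. the weak order. -/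
def isJoinIn {n : ℕ} (P : Set (SignedPerm n)) (x y u : SignedPerm n) : Prop :=
  u ∈ P ∧ wle x u ∧ wle y u ∧ ∀ z ∈ P, wle x z → wle y z → wle u z

/-- `d = Π↓(π)`: `d` is the greatest element of `{σ ∈ H_α(231) : Inv σ ⊆ Inv π}`. -/
def isProjDown {n : ℕ} (α : BComp n) (π d : SignedPerm n) : Prop :=
  mem231 α d ∧ wle d π ∧ ∀ σ, mem231 α σ → wle σ π → wle σ d

/-- `d = Π†(π)`: `d` is the greatest element of `{σ ∈ H_α(312) : Inv σ ⊆ Inv π}`. -/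
def isProjDagger {n : ℕ} (α : BComp n) (π d : SignedPerm n) : Prop :=
  mem312 α d ∧ wle d π ∧ ∀ σ, mem312 α σ → wle σ π → wle σ d

/-- The value `ω_{o;α}(a)` for `a ∈ [n]`. -/
def omegaPos {n : ℕ} (α : BComp n) (a : ℕ) : ℤ :=
  if α.isJoin = true ∧ region α a = 1 then (a : ℤ)
  else -(((pSum α (region α a) : ℤ) + (pSum α (region α a - 1) : ℤ) + 1) - (a : ℤ))

/-- The longest element `ω_{o;α}` of `H_α`, as a function on `ℤ`. -/
def omegaFun {n : ℕ} (α : BComp n) (x : ℤ) : ℤ :=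
  if 0 < x ∧ x ≤ (n : ℤ) then omegaPos α x.toNat
  else if 0 < -x ∧ -x ≤ (n : ℤ) then -(omegaPos α (-x).toNat)
  else x

/-- The set of `m` such that there is a strict chain `x₀ < x₁ < ⋯ < x_m` in `P`. -/
def chainLengths {n : ℕ} (P : Set (SignedPerm n)) : Set ℕ :=
  {m | ∃ f : Fin (m + 1) → SignedPerm n, (∀ i, f i ∈ P) ∧
        ∀ i j : Fin (m + 1), i < j → Inv (f i) ⊂ Inv (f j)}

/-- `x` is join-irreducible in `Tam_B(α)`. -/
def joinIrred {n : ℕ} (α : BComp n) (x : SignedPerm n) : Prop :=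
  x ∈ Tset α ∧ ¬ (∀ y ∈ Tset α, wle x y) ∧
  ∀ y z, y ∈ Tset α → z ∈ Tset α → isJoinIn (Tset α) y z x → x = y ∨ x = z

/-- `x` is meet-irreducible in `Tam_B(α)`. -/
def meetIrred {n : ℕ} (α : BComp n) (x : SignedPerm n) : Prop :=
  x ∈ Tset α ∧ ¬ (∀ y ∈ Tset α, wle y x) ∧
  ∀ y z, y ∈ Tset α → z ∈ Tset α → isMeetIn (Tset α) y z x → x = y ∨ x = z

/-- `x` is left modular in the lattice on `P`: `(r ∨ x) ∧ q = r ∨ (x ∧ q)`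
for all `r ≤ q` in `P`. -/
def leftModular {n : ℕ} (P : Set (SignedPerm n)) (x : SignedPerm n) : Prop :=
  ∀ r q, r ∈ P → q ∈ P → wle r q →
    ∀ u v w1 w2, isJoinIn P r x u → isMeetIn P u q v →
      isMeetIn P x q w1 → isJoinIn P r w1 w2 → v = w2

/-- The simple generator `s_i` as a function on `ℤ`: `s₀` exchanges `1` and `-1`,
and for `i ≥ 1`, `s_i` exchanges `i` with `i+1` and `-i` with `-(i+1)`. -/
def sfun (i : ℕ) (x : ℤ) : ℤ :=
  if i = 0 then (if x = 1 then -1 else if x = -1 then 1 else x)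
  else if x = (i : ℤ) then (i : ℤ) + 1
  else if x = (i : ℤ) + 1 then (i : ℤ)
  else if x = -(i : ℤ) then -(i : ℤ) - 1
  else if x = -(i : ℤ) - 1 then -(i : ℤ)
  else x

/-- `i` is one of the partial sums `p₁, …, p_{r−1}` of `α`. -/
def isPSum {n : ℕ} (α : BComp n) (i : ℕ) : Prop :=
  ∃ j : ℕ, 1 ≤ j ∧ j < α.parts.length ∧ pSum α j = i

/-- `n² − Σᵢ α_i(α_i−1)/2`, minus additionally `(α₁+1)α₁/2` when `α` is join. -/
def lengthFormula {n : ℕ} (α : BComp n) : ℕ :=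
  n ^ 2 - (α.parts.map (fun a => a * (a - 1) / 2)).sum -
    (if α.isJoin = true then (alpha1 α + 1) * alpha1 α / 2 else 0)

namespace SignedPerm

variable {n : ℕ}

theorem eq_of_perm {π σ : SignedPerm n} (h : ∀ i, π.perm i = σ.perm i) : π = σ := by
  cases π; cases σ
  congr
  exact Equiv.ext h

theorem perm_zero (z : SignedPerm n) : z.perm 0 = 0 := by
  have := z.sign_symm 0
  simp only [neg_zero] at this
  omega

theorem perm_ne {z : SignedPerm n} {p q : ℤ} (h : p ≠ q) : z.perm p ≠ z.perm q :=
  fun e => h (z.perm.injective e)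

end SignedPerm

section

variable {n : ℕ}

theorem inPM_neg {x : ℤ} (hx : inPM n x) : inPM n (-x) := by
  unfold inPM at *; omega

theorem inPM_perm (z : SignedPerm n) {x : ℤ} (hx : inPM n x) : inPM n (z.perm x) := by
  by_contra h
  have h0 : z.perm x ≠ 0 := by
    rw [← z.perm_zero]; exact SignedPerm.perm_ne hx.1
  have h1 : (n : ℤ) < |z.perm x| := by
    rw [lt_abs]; unfold inPM at h; omega
  have h2 := z.perm.injective (z.outside _ h1)
  rw [h2] at h
  exact h hx

theorem exists_perm_eq (z : SignedPerm n) {v : ℤ} (hv : inPM n v) :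
    ∃ x, inPM n x ∧ z.perm x = v := by
  refine ⟨z.perm.symm v, ?_, by simp⟩
  by_contra h
  by_cases h0 : z.perm.symm v = 0
  · have := congrArg z.perm h0
    rw [z.perm_zero] at this
    simp at this
    exact hv.1 this
  · have h1 : (n : ℤ) < |z.perm.symm v| := by
      rw [lt_abs]; unfold inPM at h; omega
    have h2 := z.outside _ h1
    simp at h2
    rw [← h2] at h
    exact h hv

/-- Along the values of `z` descending from position `i` to position `k`, a property that fails
at `i` and holds at `k` starts to hold at some pair of consecutive values. -/
theorem exists_crossing (z : SignedPerm n) (S : ℤ → Prop) :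
    ∀ (d : ℕ) (i k : ℤ), z.perm i - z.perm k ≤ d → inPM n i → inPM n k → z.perm k < z.perm i →
      ¬ S i → S k → ∃ p q, inPM n p ∧ inPM n q ∧ ¬ S p ∧ S q ∧ z.perm q < z.perm p ∧
        z.perm k ≤ z.perm q ∧ z.perm p ≤ z.perm i ∧
        ∀ r, inPM n r → z.perm r ≤ z.perm q ∨ z.perm p ≤ z.perm r := by
  intro d
  induction d with
  | zero => intro i k h; intros; omega
  | succ d ih =>
    intro i k hd hi hk hlt hSi hSk
    by_cases hr : ∀ r, inPM n r → z.perm r ≤ z.perm k ∨ z.perm i ≤ z.perm r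
    · exact ⟨i, k, hi, hk, hSi, hSk, hlt, le_rfl, le_rfl, hr⟩
    · push Not at hr
      obtain ⟨r, hr, h1, h2⟩ := hr
      by_cases hS : S r
      · obtain ⟨p, q, hp, hq, a, b, c, e, f, g⟩ := ih i r (by omega) hi hr h2 hSi hS
        exact ⟨p, q, hp, hq, a, b, c, by omega, f, g⟩
      · obtain ⟨p, q, hp, hq, a, b, c, e, f, g⟩ := ih r k (by omega) hr hk h1 hS hSk
        exact ⟨p, q, hp, hq, a, b, c, e, by omega, g⟩

/-- The exchange of `v` with `w` and of `-v` with `-w`. -/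
def swapVal (v w x : ℤ) : ℤ :=
  if x = v then w else if x = w then v else if x = -v then -w else if x = -w then -v else x

theorem swapVal_involutive {v w : ℤ} (hv : v ≠ 0) (hw : w ≠ 0) :
    Function.Involutive (swapVal v w) := by
  intro x
  unfold swapVal
  split_ifs <;> omega

/-- The signed permutation obtained from `z` by exchanging the values `v`, `w`
and the values `-v`, `-w`. -/
def SignedPerm.swap (z : SignedPerm n) (v w : ℤ) (hv : inPM n v) (hw : inPM n w) :
    SignedPerm n where
  perm := z.perm.trans (swapVal_involutive hv.1 hw.1).toPerm
  sign_symm i := by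
    have hv0 := hv.1
    have hw0 := hw.1
    simp only [Equiv.trans_apply, Function.Involutive.coe_toPerm, z.sign_symm]
    unfold swapVal
    split_ifs <;> omega
  outside i hi := by
    simp only [Equiv.trans_apply, Function.Involutive.coe_toPerm, z.outside i hi]
    rw [lt_abs] at hi
    unfold inPM at hv hw
    unfold swapVal
    split_ifs <;> omega

/-- Negation of the integers of absolute value at most `n`. -/
def negVal (n : ℕ) (x : ℤ) : ℤ := if |x| ≤ (n : ℤ) then -x else x

theorem negVal_involutive (n : ℕ) : Function.Involutive (negVal n) := by
  intro x
  unfold negVal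
  split_ifs <;> simp_all

/-- Negation of all the values of a signed permutation. -/
def SignedPerm.negate (z : SignedPerm n) : SignedPerm n where
  perm := z.perm.trans (negVal_involutive n).toPerm
  sign_symm i := by
    simp only [Equiv.trans_apply, Function.Involutive.coe_toPerm, z.sign_symm]
    unfold negVal
    rw [abs_neg]
    split_ifs <;> rfl
  outside i hi := by
    simp only [Equiv.trans_apply, Function.Involutive.coe_toPerm, z.outside i hi]
    exact if_neg (by omega)

theorem negate_perm (z : SignedPerm n) {x : ℤ} (hx : inPM n x) :
    z.negate.perm x = -z.perm x :=
  if_pos (abs_le.2 (inPM_perm z hx).2)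

theorem negate_negate (z : SignedPerm n) : z.negate.negate = z :=
  SignedPerm.eq_of_perm fun i => negVal_involutive n (z.perm i)

/-- Signed permutations that sort the positions in the same way are equal. -/
theorem eq_of_same_order {π σ : SignedPerm n}
    (h : ∀ i j, inPM n i → inPM n j → π.perm i < π.perm j → σ.perm i < σ.perm j) : π = σ := by
  have key : ∀ (π σ : SignedPerm n),
      (∀ i j, inPM n i → inPM n j → π.perm i < π.perm j → σ.perm i < σ.perm j) →
      ∀ d : ℕ, ∀ i, inPM n i → 0 < π.perm i → π.perm i ≤ d → π.perm i ≤ σ.perm i := by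
    intro π σ h d
    induction d with
    | zero => intros; omega
    | succ d ih =>
      intro i hi h0 hd
      have hpos : ∀ i, inPM n i → 0 < π.perm i → 0 < σ.perm i := by
        intro i hi h0
        have := h (-i) i (inPM_neg hi) hi (by rw [π.sign_symm]; omega)
        rw [σ.sign_symm] at this
        omega
      by_cases h1 : π.perm i = 1
      · have := hpos i hi h0; omega
      · have hv := inPM_perm π hi
        obtain ⟨j, hj, hj'⟩ := exists_perm_eq π (v := π.perm i - 1) (by unfold inPM at *; omega)
        have := ih j hj (by omega) (by omega)
        have := h j i hj hi (by omega)
        omega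
  have h' : ∀ i j, inPM n i → inPM n j → σ.perm i < σ.perm j → π.perm i < π.perm j := by
    intro i j hi hj hlt
    by_contra hc
    rcases eq_or_lt_of_le (not_lt.1 hc) with e | e
    · have := π.perm.injective e
      subst this; omega
    · have := h j i hj hi e; omega
  have hpos : ∀ i, inPM n i → 0 < π.perm i → π.perm i = σ.perm i := by
    intro i hi h0
    have h1 := key π σ h _ i hi h0 (Int.toNat_of_nonneg h0.le).ge
    have h2 := key σ π h' _ i hi (by omega) (Int.toNat_of_nonneg (by omega)).ge
    omega
  refine SignedPerm.eq_of_perm fun i => ?_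
  by_cases hi : inPM n i
  · have := (inPM_perm π hi).1
    rcases lt_or_gt_of_ne this with h0 | h0
    · have := hpos (-i) (inPM_neg hi) (by rw [π.sign_symm]; omega)
      rw [π.sign_symm, σ.sign_symm] at this
      omega
    · exact hpos i hi h0
  · by_cases h0 : i = 0
    · rw [h0, π.perm_zero, σ.perm_zero]
    · have : (n : ℤ) < |i| := by
        rw [lt_abs]; unfold inPM at hi; omega
      rw [π.outside i this, σ.outside i this]

end

/-- The data needed to define an oriented parabolic Tamari lattice on signed permutations: the
block index `β` of a position, the order `o` in which the values in a block are sorted, and the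
orientation `D` of the positions. -/
@[ext]
structure Ctx (n : ℕ) where
  β : ℤ → ℤ
  o : ℤ → ℤ
  D : ℤ → Prop
  β_neg : ∀ x, inPM n x → β (-x) = -β x
  D_neg : ∀ x, inPM n x → (D (-x) ↔ ¬ D x)

namespace Ctx

variable {n : ℕ} (C : Ctx n) {z y : SignedPerm n} {a b i k p q : ℤ}

/-- `z` sorts every block in the prescribed way. -/
def H (z : SignedPerm n) : Prop :=
  ∀ i j, inPM n i → inPM n j → C.β i = C.β j → (z.perm i < z.perm j ↔ C.o i < C.o j)

/-- Every inversion of `z` between different blocks is an inversion of `y`. -/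
def le (z y : SignedPerm n) : Prop :=
  ∀ i j, inPM n i → inPM n j → C.β i < C.β j → z.perm j < z.perm i → y.perm j < y.perm i

/-- The inversions forced by an inversion `(a, b)` of consecutive values. -/
def K (a b p q : ℤ) : Prop :=
  (p = a ∨ C.β a < C.β p ∧ C.β p < C.β b ∧ ¬ C.D p) ∧
  (q = b ∨ C.β a < C.β q ∧ C.β q < C.β b ∧ C.D q) ∧ C.β p < C.β q

/-- `z` contains all the inversions forced by `(a, b)`. -/
def J (a b : ℤ) (z : SignedPerm n) : Prop :=
  ∀ p q, inPM n p → inPM n q → C.K a b p q → z.perm q < z.perm p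

/-- `(i, k)` is an inversion between different blocks with consecutive values. -/
def Cover (z : SignedPerm n) (i k : ℤ) : Prop :=
  inPM n i ∧ inPM n k ∧ C.β i < C.β k ∧ z.perm k < z.perm i ∧
    ∀ p, inPM n p → z.perm p ≤ z.perm k ∨ z.perm i ≤ z.perm p

/-- The aligned elements. -/
def T (z : SignedPerm n) : Prop := C.H z ∧ ∀ i k, C.Cover z i k → C.J i k z

/-- The opposite context. -/
def dual : Ctx n where
  β := C.β
  o i := -C.o i
  D i := ¬ C.D i
  β_neg := C.β_neg
  D_neg x hx := by rw [C.D_neg x hx]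

theorem dual_dual : C.dual.dual = C := by
  ext <;> simp [dual]

theorem H_dual (h : C.H z) : C.dual.H z.negate := by
  intro i j hi hj e
  rw [negate_perm z hi, negate_perm z hj]
  have := h j i hj hi e.symm
  simp only [dual, neg_lt_neg_iff]
  exact this

theorem le_dual (h : C.le z y) : C.dual.le y.negate z.negate := by
  intro i j hi hj hb
  rw [negate_perm z hi, negate_perm z hj, negate_perm y hi, negate_perm y hj]
  intro hlt
  by_contra hc
  have hne : z.perm i ≠ z.perm j := SignedPerm.perm_ne (by rintro rfl; simp at hb)
  have := h i j hi hj hb (by omega)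
  omega

variable {C}

theorem le_refl (z : SignedPerm n) : C.le z z := fun _ _ _ _ _ h => h

theorem le_trans {x : SignedPerm n} (h : C.le x y) (h' : C.le y z) : C.le x z :=
  fun i j hi hj hb hx => h' i j hi hj hb (h i j hi hj hb hx)

theorem le_of_dual (h : C.dual.le y.negate z.negate) : C.le z y := by
  have := C.dual.le_dual h
  rwa [dual_dual, negate_negate, negate_negate] at this

theorem le_antisymm (hz : C.H z) (hy : C.H y) (h : C.le z y) (h' : C.le y z) : z = y := by
  refine eq_of_same_order fun i j hi hj hlt => ?_
  have hne : y.perm i ≠ y.perm j := SignedPerm.perm_ne (by rintro rfl; omega)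
  rcases lt_trichotomy (C.β i) (C.β j) with hb | hb | hb
  · by_contra hc
    have := h' i j hi hj hb (by omega)
    omega
  · exact (hy i j hi hj hb).2 ((hz i j hi hj hb).1 hlt)
  · exact h j i hj hi hb hlt

theorem J_mono (h : C.le z y) (hJ : C.J a b z) : C.J a b y :=
  fun p q hp hq hK => h p q hp hq hK.2.2 (hJ p q hp hq hK)

theorem K_self (h : C.β a < C.β b) : C.K a b a b := ⟨Or.inl rfl, Or.inl rfl, h⟩

theorem K_trans {p' q' : ℤ} (h : C.K a b p q) (h' : C.K p q p' q') : C.K a b p' q' := by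
  obtain ⟨h1, h2, h3⟩ := h
  obtain ⟨h1', h2', h3'⟩ := h'
  refine ⟨?_, ?_, h3'⟩
  · rcases h1' with rfl | ⟨u, v, w⟩
    · exact h1
    · right
      refine ⟨?_, ?_, w⟩
      · rcases h1 with rfl | h1 <;> omega
      · rcases h2 with rfl | h2 <;> omega
  · rcases h2' with rfl | ⟨u, v, w⟩
    · exact h2
    · right
      refine ⟨?_, ?_, w⟩
      · rcases h1 with rfl | h1 <;> omega
      · rcases h2 with rfl | h2 <;> omega

theorem J_of_K (hK : C.K a b p q) (hJ : C.J a b z) : C.J p q z :=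
  fun p' q' hp hq h => hJ p' q' hp hq (K_trans hK h)

theorem K_neg (ha : inPM n a) (hb : inPM n b) (hp : inPM n p) (hq : inPM n q)
    (h : C.K a b p q) : C.K (-b) (-a) (-q) (-p) := by
  unfold K at *
  rw [C.β_neg a ha, C.β_neg b hb, C.β_neg p hp, C.β_neg q hq, C.D_neg p hp, C.D_neg q hq]
  refine ⟨?_, ?_, by omega⟩
  · rcases h.2.1 with h | h
    · left; omega
    · right; exact ⟨by omega, by omega, not_not.2 h.2.2⟩
  · rcases h.1 with h | h
    · left; omega
    · right; exact ⟨by omega, by omega, h.2.2⟩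

theorem J_neg (ha : inPM n a) (hb : inPM n b) (h : C.J a b z) : C.J (-b) (-a) z := by
  intro p q hp hq hK
  have := K_neg (inPM_neg hb) (inPM_neg ha) hp hq hK
  rw [neg_neg, neg_neg] at this
  have := h (-q) (-p) (inPM_neg hq) (inPM_neg hp) this
  rw [z.sign_symm, z.sign_symm] at this
  omega

theorem Cover_neg (h : C.Cover z i k) : C.Cover z (-k) (-i) := by
  obtain ⟨hi, hk, hb, hlt, h⟩ := h
  refine ⟨inPM_neg hk, inPM_neg hi, ?_, ?_, fun p hp => ?_⟩
  · rw [C.β_neg k hk, C.β_neg i hi]; omega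
  · rw [z.sign_symm, z.sign_symm]; omega
  · have := h (-p) (inPM_neg hp)
    rw [z.sign_symm] at *
    rw [z.sign_symm]
    omega

/-- The only forced inversion of `(i, k)` with consecutive values is `(i, k)`. -/
theorem eq_of_K_of_Cover (hT : C.T z) (h : C.Cover z i k) (h' : C.Cover z p q)
    (hK : C.K i k p q) : p = i ∧ q = k := by
  have hJ := hT.2 i k h
  obtain ⟨hi, hk, hb, hlt, h⟩ := h
  obtain ⟨hp, hq, hb', hlt', h'⟩ := h'
  have h1 : z.perm k < z.perm p := by
    rcases hK.1 with rfl | hK'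
    · exact hlt
    · exact hJ p k hp hk ⟨Or.inr hK', Or.inl rfl, hK'.2.1⟩
  have h2 : z.perm q < z.perm i := by
    rcases hK.2.1 with rfl | hK'
    · exact hlt
    · exact hJ i q hi hq ⟨Or.inl rfl, Or.inr hK', hK'.1⟩
  have h3 := h p hp
  have h4 := h q hq
  have h5 := h' i hi
  have h6 := h' k hk
  exact ⟨z.perm.injective (by omega), z.perm.injective (by omega)⟩

/-- An aligned element lies below every element that satisfies the conditions imposed by its
inversions of consecutive values. -/
theorem le_of_cover (hT : C.T z) (hy : C.H y) (h : ∀ i k, C.Cover z i k → C.J i k y) :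
    C.le z y := by
  have key : ∀ (d : ℕ) (i k : ℤ), z.perm i - z.perm k ≤ d → inPM n i → inPM n k →
      C.β i < C.β k → z.perm k < z.perm i → y.perm k < y.perm i := by
    intro d
    induction d with
    | zero => intros; omega
    | succ d ih =>
      intro i k hd hi hk hb hlt
      obtain ⟨p, q, hp, hq, hSp, hSq, hqp, hkq, hpi, hno⟩ :=
        exists_crossing z (fun x => C.β i < C.β x) _ i k (Int.self_le_toNat _) hi hk hlt
          (lt_irrefl _) hb
      have hSp' : C.β p ≤ C.β i := not_lt.1 hSp
      have hSq' : C.β i < C.β q := hSq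
      have hcov : C.Cover z p q := ⟨hp, hq, by omega, hqp, hno⟩
      have hJy := h p q hcov
      have hJz := hT.2 p q hcov
      have hmono : ∀ u v, inPM n u → inPM n v → C.β u = C.β v → z.perm u ≤ z.perm v →
          y.perm u ≤ y.perm v := by
        intro u v hu hv e huv
        rcases eq_or_lt_of_le huv with e' | e'
        · rw [z.perm.injective e']
        · exact ((hy u v hu hv e).2 ((hT.1 u v hu hv e).1 e')).le
      -- the value at `i` dominates the forced lower positions of `(p, q)`
      have hdom : ∀ s, inPM n s → C.β i < C.β s → (s = q ∨ C.β s < C.β q ∧ C.D s) →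
          y.perm s < y.perm i := by
        intro s hs his hsq
        have hsq' : s = q ∨ C.β p < C.β s ∧ C.β s < C.β q ∧ C.D s := by
          rcases hsq with e | e
          · exact Or.inl e
          · exact Or.inr ⟨by omega, e⟩
        rcases eq_or_lt_of_le hSp' with e | e
        · have := hJy p s hp hs ⟨Or.inl rfl, hsq', by omega⟩
          have := hmono p i hp hi e hpi
          omega
        · by_cases hD : C.D i
          · have := hJz p i hp hi ⟨Or.inl rfl, Or.inr ⟨e, hSq', hD⟩, e⟩
            omega
          · exact hJy i s hi hs ⟨Or.inr ⟨e, hSq', hD⟩, hsq', his⟩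
      have hiq := hdom q hq hSq' (Or.inl rfl)
      rcases eq_or_lt_of_le hkq with e | e
      · rw [z.perm.injective e]; exact hiq
      · rcases lt_trichotomy (C.β q) (C.β k) with hqk | hqk | hqk
        · have := ih q k (by omega) hq hk hqk e
          omega
        · have := hmono k q hk hq hqk.symm hkq
          omega
        · refine hdom k hk hb (Or.inr ⟨hqk, ?_⟩)
          by_contra hD
          have := hJz k q hk hq ⟨Or.inr ⟨by omega, hqk, hD⟩, Or.inl rfl, hqk⟩
          omega
  exact fun i k hi hk hb hlt => key _ i k (Int.self_le_toNat _) hi hk hb hlt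

/-- If `z` is aligned and not below `y`, then some pair `(a, b)` separates `z` from `y`. -/
theorem exists_label (hT : C.T z) (hy : C.H y) (h : ¬ C.le z y) :
    ∃ a b, inPM n a ∧ inPM n b ∧ C.β a < C.β b ∧ C.J a b z ∧ C.dual.J a b y.negate := by
  have h1 : ∃ i k, C.Cover z i k ∧ ¬ C.J i k y := by
    by_contra hc
    push Not at hc
    exact h (le_of_cover hT hy hc)
  obtain ⟨i, k, hcov, hJ⟩ := h1
  have hJz := hT.2 i k hcov
  have h2 : ∃ d : ℕ, ∃ p q, (C.β q - C.β p).toNat = d ∧ inPM n p ∧ inPM n q ∧ C.K i k p q ∧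
      y.perm p < y.perm q := by
    unfold J at hJ
    push Not at hJ
    obtain ⟨p, q, hp, hq, hK, hle⟩ := hJ
    refine ⟨_, p, q, rfl, hp, hq, hK, lt_of_le_of_ne hle (SignedPerm.perm_ne ?_)⟩
    rintro rfl
    exact absurd hK.2.2 (lt_irrefl _)
  classical
  obtain ⟨p, q, hd, hp, hq, hK, hlt⟩ := Nat.find_spec h2
  have hmin : ∀ p' q', inPM n p' → inPM n q' → C.K p q p' q' → C.β q' - C.β p' < C.β q - C.β p →
      y.perm q' < y.perm p' := by
    intro p' q' hp' hq' hK' hlt'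
    by_contra hc
    refine Nat.find_min h2 (m := (C.β q' - C.β p').toNat) ?_
      ⟨p', q', rfl, hp', hq', K_trans hK hK', lt_of_le_of_ne (not_lt.1 hc) (SignedPerm.perm_ne ?_)⟩
    · rw [← hd]; have := hK.2.2; omega
    · rintro rfl
      exact absurd hK'.2.2 (lt_irrefl _)
  refine ⟨p, q, hp, hq, hK.2.2, J_of_K hK hJz, fun s t hs ht hst => ?_⟩
  rw [negate_perm y hs, negate_perm y ht, neg_lt_neg_iff]
  obtain ⟨h1, h2, h3⟩ := hst
  simp only [dual, not_not] at h1 h2 h3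
  have hs' : y.perm s ≤ y.perm p := by
    rcases h1 with rfl | h1
    · exact le_rfl
    · exact (hmin p s hp hs ⟨Or.inl rfl, Or.inr h1, h1.1⟩ (by omega)).le
  have ht' : y.perm q ≤ y.perm t := by
    rcases h2 with rfl | h2
    · exact le_rfl
    · exact (hmin t q ht hq ⟨Or.inr h2, Or.inl rfl, h2.2.1⟩ (by omega)).le
  omega

theorem not_J_and_dual (ha : inPM n a) (hb : inPM n b) (hab : C.β a < C.β b) (h : C.J a b z)
    (h' : C.dual.J a b z.negate) : False := by
  have h1 := h a b ha hb (K_self hab)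
  have h2 := h' a b ha hb (K_self (C := C.dual) hab)
  rw [negate_perm z ha, negate_perm z hb] at h2
  omega

/-- The number of inversions between different blocks. -/
noncomputable def rank (C : Ctx n) (z : SignedPerm n) : ℕ := by
  classical
  exact ((Finset.Icc (-(n : ℤ)) n ×ˢ Finset.Icc (-(n : ℤ)) n).filter
    fun t => inPM n t.1 ∧ inPM n t.2 ∧ C.β t.1 < C.β t.2 ∧ z.perm t.2 < z.perm t.1).card

theorem rank_lt (h : C.le z y) (h' : ¬ C.le y z) : C.rank z < C.rank y := by
  classical
  unfold le at h'
  push Not at h'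
  obtain ⟨i, j, hi, hj, hb, h1, h2⟩ := h'
  refine Finset.card_lt_card (Finset.ssubset_iff_of_subset ?_ |>.2 ⟨(i, j), ?_, ?_⟩)
  · intro t ht
    simp only [Finset.mem_filter] at ht ⊢
    exact ⟨ht.1, ht.2.1, ht.2.2.1, ht.2.2.2.1,
      h _ _ ht.2.1 ht.2.2.1 ht.2.2.2.1 ht.2.2.2.2⟩
  · simp only [Finset.mem_filter, Finset.mem_product, Finset.mem_Icc]
    exact ⟨⟨hi.2, hj.2⟩, hi, hj, hb, h1⟩
  · simp only [Finset.mem_filter, not_and]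
    intros; omega

theorem exists_minimal (C : Ctx n) (S : SignedPerm n → Prop) (h : S z) :
    ∃ x, S x ∧ ∀ y, S y → C.le y x → C.le x y := by
  classical
  have h' : ∃ d, ∃ x, S x ∧ C.rank x = d := ⟨_, z, h, rfl⟩
  obtain ⟨x, hx, hd⟩ := Nat.find_spec h'
  refine ⟨x, hx, fun y hy hle => ?_⟩
  by_contra hc
  exact Nat.find_min h' (hd ▸ rank_lt hle hc) ⟨y, hy, rfl⟩

theorem exists_maximal (C : Ctx n) (S : SignedPerm n → Prop) (h : S z) :
    ∃ x, S x ∧ ∀ y, S y → C.le x y → C.le y x := by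
  obtain ⟨x, hx, hmin⟩ := exists_minimal (z := z.negate) C.dual (fun x => S x.negate)
    (by rwa [negate_negate])
  refine ⟨x.negate, hx, fun y hy hle => ?_⟩
  have h1 := C.le_dual hle
  rw [negate_negate] at h1
  have h2 := C.dual.le_dual (hmin _ (by rwa [negate_negate]) h1)
  rwa [dual_dual, negate_negate] at h2

end Ctx

theorem swapVal_lt_iff {v w x y : ℤ} (hvw : w = iplus v) (hv : v ≠ 0)
    (hx : x ≠ 0) (hy : y ≠ 0) (h1 : ¬ (x = v ∧ y = w)) (h2 : ¬ (x = w ∧ y = v))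
    (h3 : ¬ (x = -w ∧ y = -v)) (h4 : ¬ (x = -v ∧ y = -w)) :
    swapVal v w x < swapVal v w y ↔ x < y := by
  unfold iplus at hvw
  unfold swapVal
  split_ifs at hvw ⊢ <;> omega

namespace Ctx

variable {n : ℕ} {C : Ctx n} {z y : SignedPerm n} {a b i k p q : ℤ}

theorem Cover_iff : C.Cover z i k ↔
    inPM n i ∧ inPM n k ∧ C.β i < C.β k ∧ z.perm i = iplus (z.perm k) := by
  constructor
  · rintro ⟨hi, hk, hb, hlt, h⟩
    refine ⟨hi, hk, hb, ?_⟩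
    have h1 := inPM_perm z hi
    have h2 := inPM_perm z hk
    obtain ⟨r, hr, hr'⟩ := exists_perm_eq z (v := iplus (z.perm k)) (by
      unfold inPM iplus at *; split_ifs <;> omega)
    have := h r hr
    rw [hr'] at this
    have h3 := h1.1
    unfold iplus at *
    split_ifs at * <;> omega
  · rintro ⟨hi, hk, hb, h⟩
    refine ⟨hi, hk, hb, ?_, fun p hp => ?_⟩
    · unfold iplus at h
      split_ifs at h <;> omega
    · have h3 := (inPM_perm z hp).1
      unfold iplus at h
      split_ifs at h <;> omega

/-- Exchanging the two consecutive values of an inversion removes only this inversion and its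
mirror image. -/
theorem exists_swap (hH : C.H z) (h : C.Cover z i k) :
    ∃ z', C.H z' ∧ C.le z' z ∧ C.dual.Cover z'.negate i k ∧
      ∀ p q, inPM n p → inPM n q → C.β p < C.β q → z.perm q < z.perm p →
        ¬ (p = i ∧ q = k) → ¬ (p = -k ∧ q = -i) → z'.perm q < z'.perm p := by
  have hlt := h.2.2.2.1
  obtain ⟨hi, hk, hb, hvw⟩ := Cover_iff.1 h
  have hv := inPM_perm z hk
  have hw := inPM_perm z hi
  have hne : i ≠ k := by rintro rfl; omega
  obtain ⟨z', hz'⟩ : ∃ z' : SignedPerm n, ∀ p, z'.perm p =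
      swapVal (z.perm k) (z.perm i) (z.perm p) := ⟨z.swap _ _ hv hw, fun _ => rfl⟩
  have hgen : ∀ p q, inPM n p → inPM n q → ¬ (p = i ∧ q = k) → ¬ (p = k ∧ q = i) →
      ¬ (p = -k ∧ q = -i) → ¬ (p = -i ∧ q = -k) →
      (z'.perm p < z'.perm q ↔ z.perm p < z.perm q) := by
    intro p q hp hq h1 h2 h3 h4
    rw [hz', hz']
    have hinj : ∀ {p i : ℤ}, z.perm p = z.perm i → p = i := fun e => z.perm.injective e
    have hinj' : ∀ {p i : ℤ}, z.perm p = -z.perm i → p = -i := fun e =>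
      z.perm.injective (by rw [e, z.sign_symm])
    exact swapVal_lt_iff hvw hv.1 (inPM_perm z hp).1 (inPM_perm z hq).1
      (fun e => h2 ⟨hinj e.1, hinj e.2⟩) (fun e => h1 ⟨hinj e.1, hinj e.2⟩)
      (fun e => h4 ⟨hinj' e.1, hinj' e.2⟩) (fun e => h3 ⟨hinj' e.1, hinj' e.2⟩)
  have hik : z'.perm i < z'.perm k := by
    rw [hz', hz']
    simp only [swapVal, if_true]
    rw [if_neg (by omega)]
    exact hlt
  have hik' : z'.perm (-k) < z'.perm (-i) := by
    rw [z'.sign_symm, z'.sign_symm]; omega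
  have hbk := C.β_neg k hk
  have hbi := C.β_neg i hi
  refine ⟨z', ?_, ?_, ⟨hi, hk, hb, ?_, ?_⟩, ?_⟩
  · intro p q hp hq hpq
    rw [hgen p q hp hq (by rintro ⟨rfl, rfl⟩; omega) (by rintro ⟨rfl, rfl⟩; omega)
      (by rintro ⟨rfl, rfl⟩; omega) (by rintro ⟨rfl, rfl⟩; omega)]
    exact hH p q hp hq hpq
  · intro p q hp hq hpq hqp
    refine (hgen q p hq hp ?_ ?_ ?_ ?_).1 hqp
    · rintro ⟨rfl, rfl⟩; omega
    · rintro ⟨rfl, rfl⟩; omega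
    · rintro ⟨rfl, rfl⟩; omega
    · rintro ⟨rfl, rfl⟩; omega
  · rw [negate_perm _ hi, negate_perm _ hk]; omega
  · intro r hr
    rw [negate_perm _ hi, negate_perm _ hk, negate_perm _ hr]
    by_cases hri : r = i
    · subst hri; omega
    by_cases hrk : r = k
    · subst hrk; omega
    have h0 := hi.1
    have h0' := hk.1
    have h1 := hgen i r hi hr (by omega) (by omega) (by omega) (by omega)
    have h2 := hgen r k hr hk (by omega) (by omega) (by omega) (by omega)
    have h3 := h.2.2.2.2 r hr
    have h4 : z.perm r ≠ z.perm i := SignedPerm.perm_ne hri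
    have h5 : z.perm r ≠ z.perm k := SignedPerm.perm_ne hrk
    omega
  · intro p q hp hq hpq hqp h1 h2
    exact (hgen q p hq hp (by rintro ⟨rfl, rfl⟩; omega) (by rintro ⟨rfl, rfl⟩; exact h1 ⟨rfl, rfl⟩)
      (by rintro ⟨rfl, rfl⟩; omega) (by rintro ⟨rfl, rfl⟩; exact h2 ⟨rfl, rfl⟩)).2 hqp

theorem lt_of_dual_Cover (h : C.dual.Cover z.negate i k) : z.perm i < z.perm k := by
  obtain ⟨hi, hk, -, hlt, -⟩ := h
  rw [negate_perm z hi, negate_perm z hk] at hlt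
  omega

/-- Removing the inversion `(i, k)` keeps the conditions that do not involve it. -/
theorem exists_swap_of_J (hH : C.H z) (h : C.Cover z i k) :
    ∃ z', C.H z' ∧ C.le z' z ∧ C.dual.Cover z'.negate i k ∧ ¬ C.le z z' ∧
      (∀ σ, C.le σ z → ¬ σ.perm k < σ.perm i → C.le σ z') ∧
      (∀ σ, C.le z' σ → σ.perm k < σ.perm i → C.le z σ) ∧
      ∀ a b, inPM n a → inPM n b → C.J a b z → ¬ C.K a b i k → ¬ C.K (-b) (-a) i k →
        C.J a b z' := by
  obtain ⟨z', h1, h2, h3, h4⟩ := exists_swap hH h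
  obtain ⟨hi, hk, hb, hlt, h⟩ := h
  refine ⟨z', h1, h2, h3, fun hle => ?_, ?_, ?_, ?_⟩
  · have := hle i k hi hk hb hlt
    have := lt_of_dual_Cover h3
    omega
  · intro σ hle hn p q hp hq hpq hqp
    refine h4 p q hp hq hpq (hle p q hp hq hpq hqp) ?_ ?_
    · rintro ⟨rfl, rfl⟩; omega
    · rintro ⟨rfl, rfl⟩
      rw [σ.sign_symm, σ.sign_symm] at hqp
      omega
  · intro σ hle hn p q hp hq hpq hqp
    by_cases e : p = i ∧ q = k
    · rwa [e.1, e.2]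
    by_cases e' : p = -k ∧ q = -i
    · rw [e'.1, e'.2, σ.sign_symm, σ.sign_symm]
      omega
    exact hle p q hp hq hpq (h4 p q hp hq hpq hqp e e')
  · intro a b ha hb' hJ hK hK' p q hp hq hpq
    refine h4 p q hp hq hpq.2.2 (hJ p q hp hq hpq) ?_ ?_
    · rintro ⟨rfl, rfl⟩; exact hK hpq
    · rintro ⟨rfl, rfl⟩
      apply hK'
      have := K_neg ha hb' hp hq hpq
      rwa [neg_neg, neg_neg] at this

/-- The condition `J a b` is satisfied by a least element, which is aligned. -/
theorem exists_least_J (ha : inPM n a) (hb : inPM n b) (hH : C.H z) (hJ : C.J a b z) :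
    ∃ x, C.T x ∧ C.J a b x ∧ ∀ y, C.H y → C.J a b y → C.le x y := by
  obtain ⟨x, ⟨hx, hxJ⟩, hmin⟩ := exists_minimal C (fun x => C.H x ∧ C.J a b x) ⟨hH, hJ⟩
  have hcov : ∀ i k, C.Cover x i k → ∀ y, C.J a b y → C.J i k y := by
    intro i k h y hy
    by_cases hK : C.K a b i k
    · exact J_of_K hK hy
    by_cases hK' : C.K (-b) (-a) i k
    · exact J_of_K hK' (J_neg ha hb hy)
    obtain ⟨z', h1, h2, -, h3, -, -, h4⟩ := exists_swap_of_J hx h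
    exact absurd (hmin z' ⟨h1, h4 a b ha hb hxJ hK hK'⟩ h2) h3
  have hT : C.T x := ⟨hx, fun i k h => hcov i k h x hxJ⟩
  exact ⟨x, hT, hxJ, fun y hy hyJ => le_of_cover hT hy fun i k h => hcov i k h y hyJ⟩

/-- If an aligned element below `z` has the inversion `(i, k)` of consecutive values of `z`, then
`z` satisfies the conditions imposed by this inversion. -/
theorem J_of_aligned_le {σ : SignedPerm n} (hσ : C.T σ) (hle : C.le σ z) (h : C.Cover z i k)
    (hlt : σ.perm k < σ.perm i) : C.J i k z := by
  have key : ∀ i k, C.Cover z i k → σ.perm k < σ.perm i →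
      ∀ j, inPM n j → C.β i < C.β j → C.β j < C.β k → C.D j → z.perm j < z.perm i := by
    intro i k ⟨hi, hk, hb, hki, hno⟩ hlt j hj hij hjk hD
    by_contra hc
    have hc' : σ.perm i < σ.perm j := by
      by_contra hc'
      have hne : σ.perm i ≠ σ.perm j := SignedPerm.perm_ne (by rintro rfl; omega)
      exact hc (hle i j hi hj hij (by omega))
    obtain ⟨p, q, hp, hq, hSp, hSq, hqp, hkq, hpi, hno'⟩ :=
      exists_crossing σ (fun x => C.β j < C.β x) _ i k (Int.self_le_toNat _) hi hk hlt
        (by omega) hjk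
    have hSp' : C.β p ≤ C.β j := not_lt.1 hSp
    have hSq' : C.β j < C.β q := hSq
    rcases eq_or_lt_of_le hSp' with e | e
    · have hne : σ.perm p ≠ σ.perm i := SignedPerm.perm_ne (by rintro rfl; omega)
      have h1 := hle i p hi hp (by omega) (by omega)
      have h2 := hle p k hp hk (by omega) (by omega)
      have := hno p hp
      omega
    · have := hσ.2 p q ⟨hp, hq, by omega, hqp, hno'⟩ p j hp hj
        ⟨Or.inl rfl, Or.inr ⟨e, hSq', hD⟩, e⟩
      omega
  have key' : ∀ j, inPM n j → C.β i < C.β j → C.β j < C.β k → ¬ C.D j → z.perm k < z.perm j := by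
    intro j hj hij hjk hD
    have hi := h.1
    have hk := h.2.1
    have := key (-k) (-i) (Cover_neg h) (by rw [σ.sign_symm, σ.sign_symm]; omega) (-j)
      (inPM_neg hj) (by rw [C.β_neg k hk, C.β_neg j hj]; omega)
      (by rw [C.β_neg i hi, C.β_neg j hj]; omega) ((C.D_neg j hj).2 hD)
    rw [z.sign_symm, z.sign_symm] at this
    omega
  intro p q hp hq ⟨hKp, hKq, hpq⟩
  have hno := h.2.2.2.2
  have hki := h.2.2.2.1
  have h1 : z.perm i ≤ z.perm p := by
    rcases hKp with rfl | hKp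
    · exact le_rfl
    · have := key' p hp hKp.1 hKp.2.1 hKp.2.2
      have := hno p hp
      omega
  have h2 : z.perm q ≤ z.perm k := by
    rcases hKq with rfl | hKq
    · exact le_rfl
    · have := key i k h hlt q hq hKq.1 hKq.2.1 hKq.2.2
      have := hno q hq
      omega
  omega

/-- If `z` is obtained from `y` by adding the inversion `(i, k)` of consecutive values and
satisfies the conditions imposed by it, then `y` satisfies the dual conditions. -/
theorem dual_J_of_J (h : C.Cover z i k) (hJ : C.J i k z) (hle : C.le y z)
    (hlt : y.perm i < y.perm k) : C.dual.J i k y.negate := by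
  obtain ⟨hi, hk, hb, hki, hno⟩ := h
  intro p q hp hq ⟨h1, h2, h3⟩
  simp only [dual, not_not] at h1 h2 h3
  rw [negate_perm y hp, negate_perm y hq, neg_lt_neg_iff]
  by_contra hc
  have hqp := hle p q hp hq h3 (lt_of_le_of_ne (not_lt.1 hc)
    (SignedPerm.perm_ne (by rintro rfl; omega)))
  have hp' : p = i ∨ z.perm p ≤ z.perm k := by
    rcases h1 with rfl | h1
    · exact Or.inl rfl
    · have := hJ i p hi hp ⟨Or.inl rfl, Or.inr h1, h1.1⟩
      have := hno p hp
      omega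
  have hq' : q = k ∨ z.perm i ≤ z.perm q := by
    rcases h2 with rfl | h2
    · exact Or.inl rfl
    · have := hJ q k hq hk ⟨Or.inr h2, Or.inl rfl, h2.2.1⟩
      have := hno q hq
      omega
  rcases hp' with rfl | hp' <;> rcases hq' with rfl | hq' <;> omega

/-- Every element of `H` has a greatest aligned element below it. -/
theorem exists_proj (hH : C.H z) :
    ∃ d, C.T d ∧ C.le d z ∧ ∀ σ, C.T σ → C.le σ z → C.le σ d := by
  obtain ⟨d, ⟨hd, hdz, hσ⟩, hmin⟩ := exists_minimal C
    (fun d => C.H d ∧ C.le d z ∧ ∀ σ, C.T σ → C.le σ z → C.le σ d)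
    ⟨hH, le_refl z, fun _ _ h => h⟩
  refine ⟨d, ⟨hd, fun i k h => ?_⟩, hdz, hσ⟩
  by_contra hJ
  obtain ⟨d', h1, h2, -, h3, h4, -, -⟩ := exists_swap_of_J hd h
  refine h3 (hmin d' ⟨h1, le_trans h2 hdz, fun σ hT hle => h4 σ (hσ σ hT hle) fun hlt => ?_⟩ h2)
  exact hJ (J_of_aligned_le hT (hσ σ hT hle) h hlt)

end Ctx

/-- `x` is irreducible for the binary least upper bounds of the relation `r` on `P`. -/
def IsIrr {X : Type*} (r : X → X → Prop) (P : X → Prop) (x : X) : Prop :=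
  P x ∧ ¬ (∀ y, P y → r x y) ∧
    ∀ y z, P y → P z → r y x → r z x → (∀ w, P w → r y w → r z w → r x w) → x = y ∨ x = z

/-- A chain of length `L` forces at least `L` irreducible elements. -/
theorem le_ncard_isIrr {X : Type*} {r : X → X → Prop} {P : X → Prop} {L : ℕ}
    (htrans : ∀ x y z, r x y → r y z → r x z) (hrefl : ∀ x, r x x)
    (hanti : ∀ x y, P x → P y → r x y → r y x → x = y)
    (hmin : ∀ (S : X → Prop) (x : X), S x → ∃ p, S p ∧ ∀ y, S y → r y p → r p y)
    (c : Fin (L + 1) → X) (hc : ∀ i, P (c i))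
    (hlt : ∀ i j, i < j → r (c i) (c j) ∧ ¬ r (c j) (c i))
    (hfin : {x | IsIrr r P x}.Finite) : L ≤ {x | IsIrr r P x}.ncard := by
  have h1 : ∀ i : Fin L, ∃ p, IsIrr r P p ∧ r p (c i.succ) ∧ ¬ r p (c i.castSucc) := by
    intro i
    obtain ⟨p, ⟨hp, hp1, hp2⟩, hm⟩ := hmin
      (fun p => P p ∧ r p (c i.succ) ∧ ¬ r p (c i.castSucc)) (c i.succ)
      ⟨hc _, hrefl _, (hlt _ _ (Fin.castSucc_lt_succ)).2⟩
    refine ⟨p, ⟨hp, fun h => hp2 (h _ (hc _)), fun y z hy hz hyp hzp hl => ?_⟩, hp1, hp2⟩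
    by_cases h : r y (c i.castSucc)
    · by_cases h' : r z (c i.castSucc)
      · exact absurd (hl _ (hc _) h h') hp2
      · exact Or.inr (hanti _ _ hp hz (hm z ⟨hz, htrans _ _ _ hzp hp1, h'⟩ hzp) hzp)
    · exact Or.inl (hanti _ _ hp hy (hm y ⟨hy, htrans _ _ _ hyp hp1, h⟩ hyp) hyp)
  choose p hp hp1 hp2 using h1
  have hle : ∀ i j : Fin L, i < j → p i ≠ p j := by
    intro i j hij he
    refine hp2 j (he ▸ ?_)
    rcases (show i.succ ≤ j.castSucc from hij).eq_or_lt with h | h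
    · exact h ▸ hp1 i
    · exact htrans _ _ _ (hp1 i) (hlt _ _ h).1
  have hinj : Function.Injective p := by
    intro i j he
    rcases lt_trichotomy i j with h | h | h
    · exact absurd he (hle i j h)
    · exact h
    · exact absurd he.symm (hle j i h)
  have h2 : (Set.range p).ncard = L := by
    rw [← Set.image_univ, Set.ncard_image_of_injective _ hinj, Set.ncard_univ, Nat.card_fin]
  rw [← h2]
  exact Set.ncard_le_ncard (by rintro _ ⟨i, rfl⟩; exact hp i) hfin

theorem finite_and_ncard_le {X Y : Type*} (S : Set X) (Λ : Finset Y) (R : X → Y → Prop)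
    (h : ∀ x ∈ S, ∃ t ∈ Λ, R x t)
    (hinj : ∀ x ∈ S, ∀ x' ∈ S, ∀ t, R x t → R x' t → x = x') :
    S.Finite ∧ S.ncard ≤ Λ.card := by
  rcases S.eq_empty_or_nonempty with rfl | ⟨x₀, hx₀⟩
  · simp
  choose f hf hR using h
  classical
  obtain ⟨g, hg⟩ : ∃ g : X → Y, ∀ x (hx : x ∈ S), g x = f x hx :=
    ⟨fun x => if hx : x ∈ S then f x hx else f x₀ hx₀, fun x hx => dif_pos hx⟩
  have h1 : Set.InjOn g S := by
    intro x hx x' hx' he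
    rw [hg x hx, hg x' hx'] at he
    refine hinj x hx x' hx' _ (hR x hx) ?_
    rw [he]
    exact hR x' hx'
  have h2 : Set.MapsTo g S Λ := fun x hx => (hg x hx).symm ▸ hf x hx
  refine ⟨Set.Finite.of_injOn h2 h1 Λ.finite_toSet, ?_⟩
  rw [← Set.ncard_coe_finset]
  exact Set.ncard_le_ncard_of_injOn g h2 h1 Λ.finite_toSet

namespace Ctx

variable {n : ℕ} {C : Ctx n} {x z y : SignedPerm n} {a b i k p q : ℤ}

variable (C) in
/-- `z` avoids all the inversions which `(a, b)` forces to be absent. -/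
def M (a b : ℤ) (z : SignedPerm n) : Prop := C.dual.J a b z.negate

variable (C) in
/-- The pairs of elements of different blocks, up to `(a, b) ↦ (-b, -a)`. -/
noncomputable def labels : Finset (ℤ × ℤ) := by
  classical
  exact (Finset.Icc (-(n : ℤ)) n ×ˢ Finset.Icc (-(n : ℤ)) n).filter
    fun t => inPM n t.1 ∧ inPM n t.2 ∧ C.β t.1 < C.β t.2 ∧ 0 ≤ t.1 + t.2

theorem mem_labels : (a, b) ∈ C.labels ↔ inPM n a ∧ inPM n b ∧ C.β a < C.β b ∧ 0 ≤ a + b := by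
  classical
  simp only [labels, Finset.mem_filter, Finset.mem_product, Finset.mem_Icc]
  unfold inPM
  constructor
  · exact fun h => h.2
  · intro h
    exact ⟨⟨h.1.2, h.2.1.2⟩, h⟩

theorem mem_labels_or (ha : inPM n a) (hb : inPM n b) (h : C.β a < C.β b) :
    (a, b) ∈ C.labels ∨ (-b, -a) ∈ C.labels := by
  rw [mem_labels, mem_labels, C.β_neg a ha, C.β_neg b hb]
  have h1 := inPM_neg ha
  have h2 := inPM_neg hb
  rcases le_total 0 (a + b) with h' | h'
  · exact Or.inl ⟨ha, hb, h, h'⟩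
  · exact Or.inr ⟨h2, h1, by omega, by omega⟩

theorem M_anti (h : C.le z y) (hM : C.M a b y) : C.M a b z := J_mono (C.le_dual h) hM

theorem M_neg (ha : inPM n a) (hb : inPM n b) (h : C.M a b z) : C.M (-b) (-a) z :=
  J_neg (C := C.dual) ha hb h

theorem H_of_dual (h : C.dual.H z) : C.H z.negate := by
  have := C.dual.H_dual h
  rwa [dual_dual] at this

theorem exists_mem_labels (hT : C.T z) (hy : C.H y) (h : ¬ C.le z y) :
    ∃ t ∈ C.labels, C.J t.1 t.2 z ∧ C.M t.1 t.2 y := by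
  obtain ⟨a, b, ha, hb, hab, hJ, hM⟩ := exists_label hT hy h
  rcases mem_labels_or ha hb hab with h' | h'
  · exact ⟨_, h', hJ, hM⟩
  · exact ⟨_, h', J_neg ha hb hJ, M_neg ha hb hM⟩

theorem not_J_and_M {t : ℤ × ℤ} (ht : t ∈ C.labels) (h : C.J t.1 t.2 z) (h' : C.M t.1 t.2 z) :
    False := by
  have := mem_labels.1 ht
  exact not_J_and_dual this.1 this.2.1 this.2.2.1 h h'

theorem J_of_meet (ha : inPM n a) (hb : inPM n b) (hx : C.T x) (hy : C.T y) (hJx : C.J a b x)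
    (hJy : C.J a b y) (hz : ∀ w, C.T w → C.le w x → C.le w y → C.le w z) : C.J a b z := by
  obtain ⟨j, hj, hJ, hle⟩ := exists_least_J ha hb hx.1 hJx
  exact J_mono (hz j hj (hle x hx.1 hJx) (hle y hy.1 hJy)) hJ

theorem M_of_join (ha : inPM n a) (hb : inPM n b) (hx : C.T x) (hy : C.T y) (hMx : C.M a b x)
    (hMy : C.M a b y) (hz : ∀ w, C.T w → C.le x w → C.le y w → C.le z w) : C.M a b z := by
  obtain ⟨m, hm, hM, hle⟩ := exists_least_J (C := C.dual) ha hb (C.H_dual hx.1) hMx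
  obtain ⟨d, hd, hdm, hproj⟩ := exists_proj (H_of_dual hm.1)
  have key : ∀ w, C.T w → C.M a b w → C.le w d := by
    intro w hw hMw
    refine hproj w hw (le_of_dual ?_)
    rw [negate_negate]
    exact hle _ (C.H_dual hw.1) hMw
  refine M_anti (le_trans (hz d hd (key x hx hMx) (key y hy hMy)) hdm) ?_
  unfold M
  rwa [negate_negate]

/-- An element all of whose labels are decided is aligned. -/
theorem T_of_forall (hH : C.H x) (h : ∀ t ∈ C.labels, C.J t.1 t.2 x ∨ C.M t.1 t.2 x) :
    C.T x := by
  refine ⟨hH, fun i k hc => ?_⟩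
  obtain ⟨hi, hk, hb, hlt, -⟩ := hc
  have h1 : ∀ i k, inPM n i → inPM n k → C.β i < C.β k → x.perm k < x.perm i →
      (i, k) ∈ C.labels → C.J i k x := by
    intro i k hi hk hb hlt ht
    refine (h _ ht).resolve_right fun hM => ?_
    have := hM i k hi hk (K_self (C := C.dual) hb)
    rw [negate_perm x hi, negate_perm x hk] at this
    omega
  rcases mem_labels_or hi hk hb with ht | ht
  · exact h1 i k hi hk hb hlt ht
  · have := h1 (-k) (-i) (inPM_neg hk) (inPM_neg hi)
      (by rw [C.β_neg i hi, C.β_neg k hk]; omega)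
      (by rw [x.sign_symm, x.sign_symm]; omega) ht
    have := J_neg (inPM_neg hk) (inPM_neg hi) this
    rwa [neg_neg, neg_neg] at this

variable (C) in
/-- `u` is the join of `y` and `z` among the aligned elements. -/
def IsJoin (y z u : SignedPerm n) : Prop :=
  C.T u ∧ C.le y u ∧ C.le z u ∧ ∀ w, C.T w → C.le y w → C.le z w → C.le u w

variable (C) in
/-- `m` is the meet of `y` and `z` among the aligned elements. -/
def IsMeet (y z m : SignedPerm n) : Prop :=
  C.T m ∧ C.le m y ∧ C.le m z ∧ ∀ w, C.T w → C.le w y → C.le w z → C.le w m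

theorem left_modular (hH : C.H x) (h : ∀ t ∈ C.labels, C.J t.1 t.2 x ∨ C.M t.1 t.2 x)
    {r u v w₁ w₂ s : SignedPerm n} (hr : C.T r) (hs : C.T s) (hrs : C.le r s)
    (hu : C.IsJoin r x u) (hv : C.IsMeet u s v) (hw₁ : C.IsMeet x s w₁)
    (hw₂ : C.IsJoin r w₁ w₂) : v = w₂ := by
  have hx := T_of_forall hH h
  refine le_antisymm hv.1.1 hw₂.1.1 ?_ ?_
  · by_contra hle
    obtain ⟨t, ht, hJ, hM⟩ := exists_mem_labels hv.1 hw₂.1.1 hle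
    obtain ⟨ha, hb, -, -⟩ := mem_labels.1 ht
    rcases h t ht with hx' | hx'
    · exact not_J_and_M ht (J_mono hw₂.2.2.1
        (J_of_meet ha hb hx hs hx' (J_mono hv.2.2.1 hJ) hw₁.2.2.2)) hM
    · exact not_J_and_M ht hJ (M_anti hv.2.1
        (M_of_join ha hb hr hx (M_anti hw₂.2.1 hM) hx' hu.2.2.2))
  · exact hw₂.2.2.2 v hv.1 (hv.2.2.2 r hr hu.2.1 hrs)
      (hv.2.2.2 w₁ hw₁.1 (le_trans hw₁.2.1 hu.2.2.1) hw₁.2.2.1)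

/-- Every strict chain of aligned elements injects into the labels. -/
theorem chain_le {m : ℕ} (f : Fin (m + 1) → SignedPerm n) (hf : ∀ i, C.T (f i))
    (hlt : ∀ i j, i < j → C.le (f i) (f j) ∧ ¬ C.le (f j) (f i)) : m ≤ C.labels.card := by
  have h1 : ∀ i : Fin m, ∃ t ∈ C.labels, C.J t.1 t.2 (f i.succ) ∧ C.M t.1 t.2 (f i.castSucc) :=
    fun i => exists_mem_labels (hf _) (hf _).1 (hlt _ _ Fin.castSucc_lt_succ).2
  choose t ht hJ hM using h1
  have hne : ∀ i j, i < j → t i ≠ t j := by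
    intro i j hij he
    refine not_J_and_M (ht j) ?_ (hM j)
    rw [← he]
    rcases (show i.succ ≤ j.castSucc from hij).eq_or_lt with h | h
    · exact h ▸ hJ i
    · exact J_mono (hlt _ _ h).1 (hJ i)
  have hinj : Function.Injective t := by
    intro i j he
    rcases lt_trichotomy i j with h | h | h
    · exact absurd he (hne i j h)
    · exact h
    · exact absurd he.symm (hne j i h)
  have := Finset.card_le_card_of_injOn (s := Finset.univ) t (fun i _ => ht i) hinj.injOn
  simpa using this

theorem exists_lower (hT : C.T x) (h : C.Cover x i k) :
    ∃ z, C.T z ∧ C.le z x ∧ ¬ C.le x z ∧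
      ∀ p q, C.Cover x p q → ¬ (p = i ∧ q = k) → ¬ (p = -k ∧ q = -i) → C.J p q z := by
  obtain ⟨x', h1, h2, -, h3, -, -, h4⟩ := exists_swap_of_J hT.1 h
  obtain ⟨z, hz, hzx, hproj⟩ := exists_proj h1
  refine ⟨z, hz, le_trans hzx h2, fun h' => h3 (le_trans h' hzx), fun p q hc hn hn' => ?_⟩
  have hJ : C.J p q x' := by
    refine h4 p q hc.1 hc.2.1 (hT.2 p q hc) (fun hK => ?_) (fun hK => ?_)
    · have := eq_of_K_of_Cover hT hc h hK
      exact hn ⟨this.1.symm, this.2.symm⟩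
    · have := eq_of_K_of_Cover hT (Cover_neg hc) h hK
      exact hn' ⟨by omega, by omega⟩
  obtain ⟨j, hj, hJj, hle⟩ := exists_least_J hc.1 hc.2.1 h1 hJ
  exact J_mono (hproj j hj (hle x' h1 hJ)) hJj

theorem exists_cover_of_isIrr (h : IsIrr C.le C.T x) :
    ∃ t ∈ C.labels, C.Cover x t.1 t.2 ∧
      ∀ p q, C.Cover x p q → (p = t.1 ∧ q = t.2) ∨ (p = -t.2 ∧ q = -t.1) := by
  obtain ⟨hT, hbot, hirr⟩ := h
  obtain ⟨i, k, hik⟩ : ∃ i k, C.Cover x i k := by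
    by_contra hc
    push Not at hc
    exact hbot fun y hy => le_of_cover hT hy.1 fun i k h => absurd h (hc i k)
  have huniq : ∀ p q, C.Cover x p q → (p = i ∧ q = k) ∨ (p = -k ∧ q = -i) := by
    intro p q hpq
    by_contra hc
    rw [not_or] at hc
    obtain ⟨z₀, h0, h0x, hx0, hJ0⟩ := exists_lower hT hik
    obtain ⟨z₁, h1, h1x, hx1, hJ1⟩ := exists_lower hT hpq
    have := hirr z₀ z₁ h0 h1 h0x h1x fun w hw hw0 hw1 => le_of_cover hT hw.1 fun i' k' h' => by
      by_cases he : (i' = i ∧ k' = k) ∨ (i' = -k ∧ k' = -i)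
      · refine J_mono hw1 (hJ1 i' k' h' ?_ ?_) <;> omega
      · rw [not_or] at he
        exact J_mono hw0 (hJ0 i' k' h' he.1 he.2)
    rcases this with rfl | rfl
    · exact hx0 (le_refl _)
    · exact hx1 (le_refl _)
  rcases mem_labels_or hik.1 hik.2.1 hik.2.2.1 with ht | ht
  · exact ⟨_, ht, hik, huniq⟩
  · refine ⟨_, ht, Cover_neg hik, fun p q hpq => ?_⟩
    have := huniq p q hpq
    simp only [neg_neg]
    omega

theorem ncard_isIrr_le :
    {x | IsIrr C.le C.T x}.Finite ∧ {x | IsIrr C.le C.T x}.ncard ≤ C.labels.card := by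
  refine finite_and_ncard_le _ _ (fun x t => C.Cover x t.1 t.2 ∧
      ∀ p q, C.Cover x p q → (p = t.1 ∧ q = t.2) ∨ (p = -t.2 ∧ q = -t.1))
    (fun x hx => exists_cover_of_isIrr hx) ?_
  have key : ∀ x x' : SignedPerm n, C.T x → C.T x' → ∀ t : ℤ × ℤ, C.Cover x' t.1 t.2 →
      (∀ p q, C.Cover x p q → (p = t.1 ∧ q = t.2) ∨ (p = -t.2 ∧ q = -t.1)) → C.le x x' := by
    intro x x' hx hx' t h' h
    refine le_of_cover hx hx'.1 fun p q hpq => ?_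
    rcases h p q hpq with ⟨rfl, rfl⟩ | ⟨rfl, rfl⟩
    · exact hx'.2 _ _ h'
    · exact hx'.2 _ _ (Cover_neg h')
  intro x hx x' hx' t h h'
  exact le_antisymm hx.1.1 hx'.1.1 (key x x' hx.1 hx'.1 t h'.1 h.2)
    (key x' x hx'.1 hx.1 t h.1 h'.2)

variable (C) in
/-- `y` is maximal among the elements whose lower aligned elements are those below `x`. -/
def IsTop (x y : SignedPerm n) : Prop :=
  (C.H y ∧ C.le x y ∧ ∀ σ, C.T σ → C.le σ y → C.le σ x) ∧
    ∀ y', (C.H y' ∧ C.le x y' ∧ ∀ σ, C.T σ → C.le σ y' → C.le σ x) → C.le y y' → C.le y' y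

theorem exists_isTop (hT : C.T x) : ∃ y, C.IsTop x y := by
  obtain ⟨y, hy, hmax⟩ := exists_maximal (z := x) C
    (fun y => C.H y ∧ C.le x y ∧ ∀ σ, C.T σ → C.le σ y → C.le σ x)
    ⟨hT.1, le_refl x, fun _ _ h => h⟩
  exact ⟨y, hy, hmax⟩

/-- An upper neighbour of a maximal element of a fibre lies above a new aligned element. -/
theorem exists_upper (h : C.IsTop x y) (hc : C.dual.Cover y.negate i k) :
    ∃ y', C.H y' ∧ C.le y y' ∧ C.Cover y' i k ∧ (∃ σ, C.T σ ∧ C.le σ y' ∧ ¬ C.le σ x) ∧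
      (∀ σ, C.le σ y' → ¬ σ.perm k < σ.perm i → C.le σ y) ∧
      ∀ a b, inPM n a → inPM n b → C.M a b y → ¬ C.dual.K a b i k →
        ¬ C.dual.K (-b) (-a) i k → C.M a b y' := by
  obtain ⟨⟨hH, hxy, hσ⟩, hmax⟩ := h
  obtain ⟨y', h1, h2, h3, h4, -, h5, h6⟩ := exists_swap_of_J (C.H_dual hH) hc
  have h2' : C.le y y'.negate := le_of_dual (by rwa [negate_negate])
  rw [dual_dual] at h3
  refine ⟨y'.negate, H_of_dual h1, h2', h3, ?_, fun σ hσ hn => ?_, ?_⟩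
  · by_contra hn
    push Not at hn
    have := C.le_dual (hmax y'.negate ⟨H_of_dual h1, le_trans hxy h2', hn⟩ h2')
    rw [negate_negate] at this
    exact h4 this
  · refine le_of_dual (h5 _ ?_ ?_)
    · have := C.le_dual hσ
      rwa [negate_negate] at this
    · have : σ.perm i ≠ σ.perm k := SignedPerm.perm_ne (by
        rintro rfl
        exact lt_irrefl _ hc.2.2.1)
      rw [negate_perm σ hc.1, negate_perm σ hc.2.1]
      omega
  · intro a b ha hb hM hK hK'
    unfold M
    rw [negate_negate]
    exact h6 a b ha hb hM hK hK'

theorem IsTop.dual_T (h : C.IsTop x y) : C.dual.T y.negate := by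
  refine ⟨C.H_dual h.1.1, fun i k hc => ?_⟩
  obtain ⟨y', h1, h2, h3, ⟨σ, hσ, hσy, hσx⟩, h4, -⟩ := exists_upper h hc
  refine dual_J_of_J h3 (J_of_aligned_le hσ hσy h3 ?_) h2 (lt_of_dual_Cover hc)
  by_contra hn
  exact hσx (h.1.2.2 σ hσ (h4 σ hσy hn))

/-- The upper covers of `y` that `z` avoids determine whether `z` is below `y`. -/
theorem le_of_dual_cover (hy : C.dual.T y.negate) (hz : C.H z)
    (h : ∀ i k, C.dual.Cover y.negate i k → C.M i k z) : C.le z y :=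
  le_of_dual (le_of_cover hy (C.H_dual hz) h)

theorem exists_higher (h : C.IsTop x y) (hT : C.T x) (hc : C.dual.Cover y.negate i k) :
    ∃ z, C.T z ∧ C.le x z ∧ ¬ C.le z x ∧
      ∀ p q, C.dual.Cover y.negate p q → ¬ (p = i ∧ q = k) → ¬ (p = -k ∧ q = -i) →
        C.M p q z := by
  have hyT := h.dual_T
  obtain ⟨y', h1, h2, h3, ⟨σ, hσ, hσy, hσx⟩, -, h4⟩ := exists_upper h hc
  obtain ⟨z, hz, hzy, hproj⟩ := exists_proj h1
  refine ⟨z, hz, hproj x hT (le_trans h.1.2.1 h2), fun h' => hσx (le_trans (hproj σ hσ hσy) h'),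
    fun p q hpq hn hn' => M_anti hzy ?_⟩
  refine h4 p q hpq.1 hpq.2.1 (hyT.2 p q hpq) (fun hK => ?_) (fun hK => ?_)
  · have := eq_of_K_of_Cover hyT hpq hc hK
    exact hn ⟨this.1.symm, this.2.symm⟩
  · have := eq_of_K_of_Cover hyT (Cover_neg hpq) hc hK
    exact hn' ⟨by omega, by omega⟩

theorem exists_dual_cover_of_isIrr (h : IsIrr (flip C.le) C.T x) :
    ∃ t ∈ C.labels, ∃ y, C.IsTop x y ∧ C.dual.Cover y.negate t.1 t.2 ∧
      ∀ p q, C.dual.Cover y.negate p q →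
        (p = t.1 ∧ q = t.2) ∨ (p = -t.2 ∧ q = -t.1) := by
  obtain ⟨hT, htop, hirr⟩ := h
  obtain ⟨y, hy⟩ := exists_isTop hT
  have hyT := hy.dual_T
  obtain ⟨i, k, hik⟩ : ∃ i k, C.dual.Cover y.negate i k := by
    by_contra hc
    push Not at hc
    exact htop fun w hw => hy.1.2.2 w hw
      (le_of_dual_cover hyT hw.1 fun i k h => absurd h (hc i k))
  have huniq : ∀ p q, C.dual.Cover y.negate p q → (p = i ∧ q = k) ∨ (p = -k ∧ q = -i) := by
    intro p q hpq
    by_contra hc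
    rw [not_or] at hc
    obtain ⟨z₀, h0, h0x, hx0, hM0⟩ := exists_higher hy hT hik
    obtain ⟨z₁, h1, h1x, hx1, hM1⟩ := exists_higher hy hT hpq
    have := hirr z₀ z₁ h0 h1 h0x h1x fun w hw hw0 hw1 => hy.1.2.2 w hw <|
      le_of_dual_cover hyT hw.1 fun i' k' h' => by
        by_cases he : (i' = i ∧ k' = k) ∨ (i' = -k ∧ k' = -i)
        · refine M_anti hw1 (hM1 i' k' h' ?_ ?_) <;> omega
        · rw [not_or] at he
          exact M_anti hw0 (hM0 i' k' h' he.1 he.2)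
    rcases this with rfl | rfl
    · exact hx0 (le_refl _)
    · exact hx1 (le_refl _)
  rcases mem_labels_or hik.1 hik.2.1 hik.2.2.1 with ht | ht
  · exact ⟨_, ht, y, hy, hik, huniq⟩
  · refine ⟨_, ht, y, hy, Cover_neg hik, fun p q hpq => ?_⟩
    have := huniq p q hpq
    simp only [neg_neg]
    omega

theorem ncard_isIrr_flip_le :
    {x | IsIrr (flip C.le) C.T x}.Finite ∧
      {x | IsIrr (flip C.le) C.T x}.ncard ≤ C.labels.card := by
  refine finite_and_ncard_le _ _ (fun x t => ∃ y, C.IsTop x y ∧ C.dual.Cover y.negate t.1 t.2 ∧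
      ∀ p q, C.dual.Cover y.negate p q → (p = t.1 ∧ q = t.2) ∨ (p = -t.2 ∧ q = -t.1))
    (fun x hx => exists_dual_cover_of_isIrr hx) ?_
  have key : ∀ x x' y y' : SignedPerm n, C.T x → C.IsTop x y → C.IsTop x' y' → ∀ t : ℤ × ℤ,
      C.dual.Cover y.negate t.1 t.2 →
      (∀ p q, C.dual.Cover y'.negate p q → (p = t.1 ∧ q = t.2) ∨ (p = -t.2 ∧ q = -t.1)) →
      C.le x x' := by
    intro x x' y y' hT hy hy' t hc h
    refine hy'.1.2.2 x hT (le_trans hy.1.2.1 ?_)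
    refine le_of_dual_cover hy'.dual_T hy.1.1 fun p q hpq => ?_
    rcases h p q hpq with ⟨rfl, rfl⟩ | ⟨rfl, rfl⟩
    · exact hy.dual_T.2 _ _ hc
    · exact hy.dual_T.2 _ _ (Cover_neg hc)
  rintro x hx x' hx' t ⟨y, hy, h1, h2⟩ ⟨y', hy', h1', h2'⟩
  exact le_antisymm hx.1.1 hx'.1.1 (key x x' y y' hx.1 hy hy' t h1 h2')
    (key x' x y' y hx'.1 hy' hy t h1' h2)

/-- If some chain decides the labels one at a time, then the aligned elements form a trim
lattice. -/
theorem trim_of_chain (c : Fin (C.labels.card + 1) → SignedPerm n) (t : Fin C.labels.card → ℤ × ℤ)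
    (ht : Set.SurjOn t Set.univ C.labels) (ht' : ∀ j, t j ∈ C.labels) (hH : ∀ i, C.H (c i))
    (hJ : ∀ i j, j.castSucc < i → C.J (t j).1 (t j).2 (c i))
    (hM : ∀ i j, i ≤ j.castSucc → C.M (t j).1 (t j).2 (c i)) :
    (∀ i, C.T (c i)) ∧ (∀ i j, i < j → C.le (c i) (c j) ∧ ¬ C.le (c j) (c i)) ∧
      {x | IsIrr C.le C.T x}.ncard = C.labels.card ∧
      {x | IsIrr (flip C.le) C.T x}.ncard = C.labels.card ∧
      ∀ i, ∀ t ∈ C.labels, C.J t.1 t.2 (c i) ∨ C.M t.1 t.2 (c i) := by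
  have hdec : ∀ i, ∀ t ∈ C.labels, C.J t.1 t.2 (c i) ∨ C.M t.1 t.2 (c i) := by
    intro i s hs
    obtain ⟨j, -, rfl⟩ := ht hs
    exact (lt_or_ge j.castSucc i).imp (hJ i j) (hM i j)
  have hT : ∀ i, C.T (c i) := fun i => T_of_forall (hH i) (hdec i)
  have hlt : ∀ i j, i < j → C.le (c i) (c j) ∧ ¬ C.le (c j) (c i) := by
    intro i j hij
    constructor
    · by_contra hle
      obtain ⟨s, hs, hJs, hMs⟩ := exists_mem_labels (hT i) (hH j) hle
      obtain ⟨l, -, rfl⟩ := ht hs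
      rcases lt_or_ge l.castSucc i with h | h
      · exact not_J_and_M hs (hJ j l (h.trans hij)) hMs
      · exact not_J_and_M hs hJs (hM i l h)
    · intro hle
      obtain ⟨l, rfl⟩ : ∃ l : Fin C.labels.card, l.castSucc = i :=
        ⟨i.castPred (Fin.ne_last_of_lt hij), Fin.castSucc_castPred _ _⟩
      exact not_J_and_M (ht' l) (hJ j l hij) (M_anti hle (hM _ l le_rfl))
  refine ⟨hT, hlt, _root_.le_antisymm ncard_isIrr_le.2 ?_,
    _root_.le_antisymm ncard_isIrr_flip_le.2 ?_, hdec⟩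
  · exact le_ncard_isIrr (fun _ _ _ => le_trans) le_refl
      (fun x y hx hy => le_antisymm hx.1 hy.1) (fun S x => exists_minimal C S) c hT hlt
      ncard_isIrr_le.1
  · exact le_ncard_isIrr (fun _ _ _ h h' => le_trans h' h) le_refl
      (fun x y hx hy h h' => le_antisymm hx.1 hy.1 h' h) (fun S x => exists_maximal C S)
      (fun i => c i.rev) (fun i => hT _) (fun i j hij => hlt _ _ (Fin.rev_lt_rev.2 hij))
      ncard_isIrr_flip_le.1

end Ctx

/-- An odd injective key on `±[n]` is sorted by a sign-symmetric permutation. -/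
theorem exists_sort {n : ℕ} (f : ℤ → ℤ) (hodd : ∀ x, inPM n x → f (-x) = -f x)
    (hinj : ∀ x y, inPM n x → inPM n y → f x = f y → x = y) :
    ∃ z : SignedPerm n, ∀ i j, inPM n i → inPM n j → (z.perm i < z.perm j ↔ f i < f j) := by
  classical
  have hf0 : ∀ x, inPM n x → f x ≠ 0 := by
    intro x hx h0
    have h1 := hodd x hx
    have h2 := hinj (-x) x (inPM_neg hx) hx (by omega)
    have := hx.1
    omega
  let P : Finset ℤ := (Finset.Icc (-(n : ℤ)) n).filter (inPM n)
  have hP : ∀ x, x ∈ P ↔ inPM n x := by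
    intro x
    simp only [P, Finset.mem_filter, Finset.mem_Icc]
    exact ⟨fun h => h.2, fun h => ⟨h.2, h⟩⟩
  let N : ℤ → Finset ℤ := fun v => P.filter fun y => 0 < f y ∧ f y ≤ v
  have hN : ∀ v, (N v).card ≤ n := by
    intro v
    have : (N v).card ≤ (Finset.Icc 1 n).card := by
      refine Finset.card_le_card_of_injOn Int.natAbs ?_ ?_
      · intro y hy
        have hy' := (hP y).1 (Finset.mem_filter.1 hy).1
        have := hy'.1
        have := hy'.2
        simp only [Finset.coe_Icc, Set.mem_Icc]
        omega
      · intro y hy y' hy' he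
        have hy := Finset.mem_filter.1 hy
        have hy' := Finset.mem_filter.1 hy'
        rcases Int.natAbs_eq_natAbs_iff.1 he with h | h
        · exact h
        · have := hodd y' ((hP y').1 hy'.1)
          rw [← h] at this
          omega
    simpa using this
  let g : ℤ → ℤ := fun x =>
    if inPM n x then (if 0 < f x then ((N (f x)).card : ℤ) else -((N (-f x)).card : ℤ)) else x
  have hgpos : ∀ x, inPM n x → 0 < f x → g x = (N (f x)).card := by
    intro x hx h
    simp only [g, if_pos hx, if_pos h]
  have hgodd : ∀ x, g (-x) = -g x := by
    intro x
    by_cases hx : inPM n x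
    · have h1 := hf0 x hx
      simp only [g, if_pos hx, if_pos (inPM_neg hx), hodd x hx]
      split_ifs <;> first | omega | simp
    · have : ¬ inPM n (-x) := fun h => hx (by simpa using inPM_neg h)
      simp only [g, if_neg hx, if_neg this]
  have hgP : ∀ x, inPM n x → 0 < f x → 0 < g x ∧ g x ≤ n := by
    intro x hx h
    rw [hgpos x hx h]
    have : 0 < (N (f x)).card :=
      Finset.card_pos.2 ⟨x, Finset.mem_filter.2 ⟨(hP x).2 hx, h, le_rfl⟩⟩
    have := hN (f x)
    omega
  have hgP' : ∀ x, inPM n x → f x < 0 → -(n : ℤ) ≤ g x ∧ g x < 0 := by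
    intro x hx h
    have := hgP (-x) (inPM_neg hx) (by rw [hodd x hx]; omega)
    rw [hgodd] at this
    omega
  have hlt : ∀ i j, inPM n i → inPM n j → 0 < f i → f i < f j → g i < g j := by
    intro i j hi hj h0 h
    rw [hgpos i hi h0, hgpos j hj (h0.trans h), Nat.cast_lt]
    refine Finset.card_lt_card (Finset.ssubset_iff_of_subset ?_ |>.2 ⟨j, ?_, ?_⟩)
    · intro y hy
      have hy := Finset.mem_filter.1 hy
      exact Finset.mem_filter.2 ⟨hy.1, hy.2.1, hy.2.2.trans h.le⟩
    · exact Finset.mem_filter.2 ⟨(hP j).2 hj, h0.trans h, le_rfl⟩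
    · intro hy
      have := (Finset.mem_filter.1 hy).2.2
      omega
  have hmono : ∀ i j, inPM n i → inPM n j → f i < f j → g i < g j := by
    intro i j hi hj h
    have hi0 := hf0 i hi
    have hj0 := hf0 j hj
    by_cases h0 : 0 < f i
    · exact hlt i j hi hj h0 h
    by_cases h0' : 0 < f j
    · have := hgP j hj h0'
      have := hgP' i hi (by omega)
      omega
    · have := hlt (-j) (-i) (inPM_neg hj) (inPM_neg hi) (by rw [hodd j hj]; omega)
        (by rw [hodd j hj, hodd i hi]; omega)
      rw [hgodd, hgodd] at this
      omega
  have hmaps : ∀ x, inPM n x → inPM n (g x) := by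
    intro x hx
    have := hf0 x hx
    unfold inPM
    rcases lt_or_gt_of_ne this with h | h
    · have := hgP' x hx h
      omega
    · have := hgP x hx h
      omega
  have hginj : ∀ x y, inPM n x → inPM n y → g x = g y → x = y := by
    intro x y hx hy h
    by_contra hne
    rcases lt_or_gt_of_ne (fun he => hne (hinj x y hx hy he)) with h' | h'
    · exact (hmono x y hx hy h').ne h
    · exact (hmono y x hy hx h').ne' h
  have hout : ∀ x, ¬ inPM n x → g x = x := fun x hx => if_neg hx
  have hbij : Function.Bijective g := by
    constructor
    · intro x y h
      by_cases hx : inPM n x <;> by_cases hy : inPM n y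
      · exact hginj x y hx hy h
      · rw [hout y hy] at h
        exact absurd (h ▸ hmaps x hx) hy
      · rw [hout x hx] at h
        exact absurd (h.symm ▸ hmaps y hy) hx
      · rwa [hout x hx, hout y hy] at h
    · intro y
      by_cases hy : inPM n y
      · have hs : Set.SurjOn g P P := Finset.surjOn_of_injOn_of_card_le g
          (fun x hx => (hP _).2 (hmaps x ((hP x).1 hx)))
          (fun x hx y hy h => hginj x y ((hP x).1 hx) ((hP y).1 hy) h) le_rfl
        obtain ⟨x, -, hx⟩ := hs ((hP y).2 hy)
        exact ⟨x, hx⟩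
      · exact ⟨y, hout y hy⟩
  refine ⟨⟨Equiv.ofBijective g hbij, hgodd, fun i hi => hout i fun h => ?_⟩, fun i j hi hj => ?_⟩
  · have := h.2
    rw [lt_abs] at hi
    omega
  · change g i < g j ↔ f i < f j
    refine ⟨fun h => ?_, hmono i j hi hj⟩
    by_contra hc
    rcases (not_lt.1 hc).eq_or_lt with h' | h'
    · rw [hinj j i hj hi h'] at h
      exact lt_irrefl _ h
    · exact lt_asymm h (hmono j i hj hi h')

/-- Sorting by levels, where elements on the same level keep their order. -/
theorem exists_sort_lex {n : ℕ} (f : ℤ → ℤ) (hodd : ∀ x, inPM n x → f (-x) = -f x) :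
    ∃ z : SignedPerm n, ∀ i j, inPM n i → inPM n j →
      (z.perm i < z.perm j ↔ f i < f j ∨ f i = f j ∧ i < j) := by
  have key : ∀ i j, inPM n i → inPM n j →
      (f i * (2 * n + 1) + i < f j * (2 * n + 1) + j ↔ f i < f j ∨ f i = f j ∧ i < j) := by
    intro i j hi hj
    have h1 := hi.2
    have h2 := hj.2
    rcases lt_trichotomy (f i) (f j) with h | h | h
    · have : (f j - f i - 1) * (2 * n + 1) ≥ 0 := mul_nonneg (by omega) (by omega)
      have : f i * (2 * n + 1) + i < f j * (2 * n + 1) + j := by linarith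
      simp [this, h]
    · rw [h]
      simp
    · have : (f i - f j - 1) * (2 * n + 1) ≥ 0 := mul_nonneg (by omega) (by omega)
      have : ¬ f i * (2 * n + 1) + i < f j * (2 * n + 1) + j := by linarith
      simp only [this, false_iff]
      omega
  obtain ⟨z, hz⟩ := exists_sort (n := n) (fun x => f x * (2 * n + 1) + x)
    (fun x hx => by simp only [hodd x hx]; ring)
    (fun x y hx hy h => by
      have h1 := key x y hx hy
      have h2 := key y x hy hx
      change f x * (2 * n + 1) + x = f y * (2 * n + 1) + y at h
      rw [h] at h1 h2
      simp only [lt_self_iff_false, false_iff] at h1 h2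
      omega)
  exact ⟨z, fun i j hi hj => (hz i j hi hj).trans (key i j hi hj)⟩

section Blocks

variable {n : ℕ} (α : BComp n)

theorem parts_ne_nil {a : ℕ} (h : 1 ≤ a) (ha : a ≤ n) : α.parts ≠ [] := by
  intro hn
  have := α.sum_eq
  rw [hn, List.sum_nil] at this
  omega

theorem region_pos {a : ℕ} (h : 1 ≤ a) (ha : a ≤ n) : 1 ≤ region α a := by
  refine Finset.card_pos.2 ⟨0, Finset.mem_filter.2 ⟨Finset.mem_range.2 ?_, ?_⟩⟩
  · exact List.length_pos_iff.2 (parts_ne_nil α h ha)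
  · simp only [pSum, List.take_zero, List.sum_nil]
    omega

theorem region_mono {a b : ℕ} (h : a ≤ b) : region α a ≤ region α b :=
  Finset.card_le_card fun j hj => by
    rw [Finset.mem_filter] at hj ⊢
    exact ⟨hj.1, hj.2.trans_le h⟩

theorem region_eq_one_iff {a : ℕ} (h : 1 ≤ a) (ha : a ≤ n) :
    region α a = 1 ↔ a ≤ alpha1 α := by
  obtain ⟨d, t, hdt⟩ := List.exists_cons_of_ne_nil (parts_ne_nil α h ha)
  have hsum := α.sum_eq
  have hr := region_pos α h ha
  unfold alpha1
  unfold region pSum at *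
  rw [hdt] at hsum hr ⊢
  simp only [List.headI_cons, List.length_cons, List.sum_cons] at *
  constructor
  · intro h1
    by_contra hlt
    have ht : 0 < t.length := by
      rw [List.length_pos_iff]
      rintro rfl
      simp only [List.sum_nil] at hsum
      omega
    have h2 : ({0, 1} : Finset ℕ) ⊆ (Finset.range (t.length + 1)).filter
        fun j => ((d :: t).take j).sum < a := by
      intro j hj
      simp only [Finset.mem_insert, Finset.mem_singleton] at hj
      rw [Finset.mem_filter, Finset.mem_range]
      rcases hj with rfl | rfl
      · simp only [List.take_zero, List.sum_nil]
        omega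
      · simp only [List.take_succ_cons, List.take_zero, List.sum_cons, List.sum_nil]
        omega
    have := Finset.card_le_card h2
    rw [h1] at this
    simp at this
  · intro hle
    refine le_antisymm ?_ hr
    rw [Finset.card_le_one]
    have h0 : ∀ j ∈ (Finset.range (t.length + 1)).filter
        (fun j => ((d :: t).take j).sum < a), j = 0 := by
      intro j hj
      rw [Finset.mem_filter] at hj
      rcases j with _ | j
      · rfl
      · have := hj.2
        simp only [List.take_succ_cons, List.sum_cons] at this
        omega
    intro i hi j hj
    rw [h0 i hi, h0 j hj]

theorem blockIdx_neg {x : ℤ} (hx : x ≠ 0) : blockIdx α (-x) = -blockIdx α x := by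
  unfold blockIdx
  rcases lt_or_gt_of_ne hx with h | h
  · rw [if_pos (show 0 < -x by omega), if_neg (show ¬ 0 < x by omega)]
    split_ifs <;> simp
  · rw [if_neg (show ¬ 0 < -x by omega), if_pos h, neg_neg]
    split_ifs <;> simp

theorem blockIdx_nonneg {x : ℤ} (hx : 0 < x) : 0 ≤ blockIdx α x := by
  unfold blockIdx
  rw [if_pos hx]
  split_ifs <;> omega

theorem blockIdx_eq_zero_iff {x : ℤ} (hx : 0 < x) (hxn : x ≤ n) :
    blockIdx α x = 0 ↔ α.isJoin = true ∧ x ≤ alpha1 α := by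
  have h1 := region_pos α (a := x.toNat) (by omega) (by omega)
  have h2 := region_eq_one_iff α (a := x.toNat) (by omega) (by omega)
  unfold blockIdx
  simp only [if_pos hx, h2, Int.toNat_le]
  split_ifs with h
  · simp [h]
  · simp only [h, iff_false]
    omega

theorem blockIdx_mono_pos {x y : ℤ} (hx : 0 < x) (hxy : x ≤ y) (hy : y ≤ n) :
    blockIdx α x ≤ blockIdx α y := by
  have h1 := region_pos α (a := x.toNat) (by omega) (by omega)
  have h2 := region_mono α (a := x.toNat) (b := y.toNat) (by omega)
  unfold blockIdx
  rw [if_pos hx, if_pos (show 0 < y by omega)]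
  split_ifs with h h' h' <;> try omega
  exact absurd ⟨h'.1, by omega⟩ h

theorem blockIdx_mono {x y : ℤ} (hx : inPM n x) (hy : inPM n y) (hxy : x ≤ y) :
    blockIdx α x ≤ blockIdx α y := by
  obtain ⟨hx0, hx1, hx2⟩ := hx
  obtain ⟨hy0, hy1, hy2⟩ := hy
  have h1 := blockIdx_neg α hx0
  have h2 := blockIdx_neg α hy0
  rcases lt_or_gt_of_ne hx0 with h | h
  · have h3 := blockIdx_nonneg α (x := -x) (by omega)
    rcases lt_or_gt_of_ne hy0 with h' | h'
    · have := blockIdx_mono_pos α (x := -y) (y := -x) (by omega) (by omega) (by omega)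
      omega
    · have := blockIdx_nonneg α h'
      omega
  · exact blockIdx_mono_pos α h hxy hy2

theorem lt_of_blockIdx_lt {x y : ℤ} (hx : inPM n x) (hy : inPM n y)
    (h : blockIdx α x < blockIdx α y) : x < y := by
  by_contra hc
  have := blockIdx_mono α hy hx (not_lt.1 hc)
  omega

/-- The context of `Tam_B(α)`. -/
def ctx : Ctx n where
  β := blockIdx α
  o x := x
  D x := 0 < blockIdx α x ∨ blockIdx α x = 0 ∧ x < 0
  β_neg x hx := blockIdx_neg α hx.1
  D_neg x hx := by
    rw [blockIdx_neg α hx.1]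
    have := hx.1
    omega

variable {α} {z y : SignedPerm n}

theorem memH_iff : memH α z ↔ (ctx α).H z := by
  constructor
  · intro h i j hi hj hb
    refine ⟨fun hlt => ?_, fun hlt => h i j hi hj hlt hb⟩
    by_contra hc
    rcases (not_lt.1 hc).eq_or_lt with e | hlt'
    · change j = i at e
      rw [e] at hlt
      exact lt_irrefl _ hlt
    · have := h j i hj hi hlt' hb.symm
      omega
  · exact fun h a b ha hb hlt hab => (h a b ha hb hab).2 hlt

theorem ctx_D_iff {j : ℤ} (h : 0 < j) (hn : j ≤ n) :
    (ctx α).D j ↔ ¬ (α.isJoin = true ∧ j ≤ alpha1 α) := by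
  rw [← blockIdx_eq_zero_iff α h hn]
  have := blockIdx_nonneg α h
  simp only [ctx]
  omega

theorem has231_iff : has231 α z ↔ ∃ i j k, (ctx α).Cover z i k ∧ inPM n j ∧ 0 < j ∧
    blockIdx α i < blockIdx α j ∧ blockIdx α j < blockIdx α k ∧
    ((ctx α).D j ∧ z.perm i < z.perm j ∨ ¬ (ctx α).D j ∧ z.perm j < z.perm k) := by
  have key : ∀ i j k, inPM n j → 0 < j →
      ((if α.isJoin = true then
         (((alpha1 α : ℤ) < j → z.perm i < z.perm j) ∧
          (j ≤ (alpha1 α : ℤ) → z.perm j < z.perm k))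
       else z.perm i < z.perm j) ↔
      ((ctx α).D j ∧ z.perm i < z.perm j ∨ ¬ (ctx α).D j ∧ z.perm j < z.perm k)) := by
    intro i j k hj h0
    rw [ctx_D_iff h0 hj.2.2]
    rcases α.isJoin
    · simp
    · simp only [if_true, true_and, not_le, not_lt]
      omega
  constructor
  · rintro ⟨i, j, k, ⟨hi, hj, hk, hij, hjk, h0, b1, b2, b3, he⟩, h⟩
    have h1 := lt_of_le_of_ne (blockIdx_mono α hi hj hij.le) b1
    have h2 := lt_of_le_of_ne (blockIdx_mono α hj hk hjk.le) b2
    exact ⟨i, j, k, Ctx.Cover_iff.2 ⟨hi, hk, h1.trans h2, he⟩, hj, h0, h1, h2,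
      (key i j k hj h0).1 h⟩
  · rintro ⟨i, j, k, hc, hj, h0, h1, h2, h⟩
    obtain ⟨hi, hk, -, he⟩ := Ctx.Cover_iff.1 hc
    exact ⟨i, j, k, ⟨hi, hj, hk, lt_of_blockIdx_lt α hi hj h1, lt_of_blockIdx_lt α hj hk h2, h0,
      h1.ne, h2.ne, (h1.trans h2).ne, he⟩, (key i j k hj h0).2 h⟩

theorem mem231_iff : mem231 α z ↔ (ctx α).T z := by
  unfold mem231 Ctx.T
  rw [memH_iff, has231_iff]
  refine and_congr_right fun hH => ?_
  constructor
  · intro h i k hc p q hp hq ⟨h1, h2, h3⟩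
    have hbad : ∀ j, inPM n j → blockIdx α i < blockIdx α j → blockIdx α j < blockIdx α k →
        ¬ ((ctx α).D j ∧ z.perm i < z.perm j ∨ ¬ (ctx α).D j ∧ z.perm j < z.perm k) := by
      intro j hj h1 h2 hD
      rcases lt_or_gt_of_ne hj.1 with h0 | h0
      · refine h ⟨-k, -j, -i, Ctx.Cover_neg hc, inPM_neg hj, by omega, ?_, ?_, ?_⟩
        · rw [blockIdx_neg α hc.2.1.1, blockIdx_neg α hj.1]
          omega
        · rw [blockIdx_neg α hc.1.1, blockIdx_neg α hj.1]
          omega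
        · rw [(ctx α).D_neg j hj, z.sign_symm, z.sign_symm, z.sign_symm, neg_lt_neg_iff,
            neg_lt_neg_iff, not_not]
          exact hD.symm
      · exact h ⟨i, j, k, hc, hj, h0, h1, h2, hD⟩
    have hno := hc.2.2.2.2
    have hp' : z.perm i ≤ z.perm p := by
      rcases h1 with rfl | ⟨u, v, w⟩
      · exact le_rfl
      · have h4 : z.perm p ≠ z.perm k := SignedPerm.perm_ne (by rintro rfl; exact lt_irrefl _ v)
        have h5 : ¬ z.perm p < z.perm k := fun h5 => hbad p hp u v (Or.inr ⟨w, h5⟩)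
        have := hno p hp
        omega
    have hq' : z.perm q ≤ z.perm k := by
      rcases h2 with rfl | ⟨u, v, w⟩
      · exact le_rfl
      · have h4 : z.perm q ≠ z.perm i := SignedPerm.perm_ne (by rintro rfl; exact lt_irrefl _ u)
        have h5 : ¬ z.perm i < z.perm q := fun h5 => hbad q hq u v (Or.inl ⟨w, h5⟩)
        have := hno q hq
        omega
    have := hc.2.2.2.1
    omega
  · rintro h ⟨i, j, k, hc, hj, -, h1, h2, ⟨hD, hlt⟩ | ⟨hD, hlt⟩⟩
    · have := h i k hc i j hc.1 hj ⟨Or.inl rfl, Or.inr ⟨h1, h2, hD⟩, h1⟩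
      omega
    · have := h i k hc j k hj hc.2.1 ⟨Or.inr ⟨h1, h2, hD⟩, Or.inl rfl, h2⟩
      omega

theorem wle_iff : wle z y ↔ ∀ p q, inPM n p → inPM n q → p < q → z.perm q < z.perm p →
    y.perm q < y.perm p := by
  constructor
  · intro h
    have hpair : ∀ p q : ℕ, 1 ≤ p → p < q → q ≤ n → z.perm q < z.perm p →
        y.perm q < y.perm p := fun p q h1 h2 h3 h4 =>
      (h (show BInv.pair p q ∈ Inv z from ⟨h1, h2, h3, h4⟩)).2.2.2
    have hneg : ∀ p : ℕ, 1 ≤ p → p ≤ n → z.perm p < 0 → y.perm p < 0 := fun p h1 h2 h3 =>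
      (h (show BInv.neg p ∈ Inv z from ⟨h1, h2, h3⟩)).2.2
    have hmix : ∀ p q : ℕ, 1 ≤ p → p < q → q ≤ n → z.perm p + z.perm q < 0 →
        y.perm p + y.perm q < 0 := fun p q h1 h2 h3 h4 =>
      (h (show BInv.mixed p q ∈ Inv z from ⟨h1, h2, h3, h4⟩)).2.2.2
    intro p q ⟨hp0, hp1, hp2⟩ ⟨hq0, hq1, hq2⟩ hpq hlt
    rcases lt_or_gt_of_ne hp0 with hp | hp
    · obtain ⟨m, rfl⟩ : ∃ m : ℕ, p = -m := ⟨p.natAbs, by omega⟩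
      rw [z.sign_symm] at hlt
      rw [y.sign_symm]
      rcases lt_or_gt_of_ne hq0 with hq | hq
      · obtain ⟨l, rfl⟩ : ∃ l : ℕ, q = -l := ⟨q.natAbs, by omega⟩
        rw [z.sign_symm] at hlt
        rw [y.sign_symm]
        have := hpair l m (by omega) (by omega) (by omega) (by omega)
        omega
      · obtain ⟨l, rfl⟩ : ∃ l : ℕ, q = l := ⟨q.natAbs, by omega⟩
        rcases lt_trichotomy m l with h | rfl | h
        · have := hmix m l (by omega) (by omega) (by omega) (by omega)
          omega
        · have := hneg m (by omega) (by omega) (by omega)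
          omega
        · have := hmix l m (by omega) (by omega) (by omega) (by omega)
          omega
    · obtain ⟨m, rfl⟩ : ∃ m : ℕ, p = m := ⟨p.natAbs, by omega⟩
      obtain ⟨l, rfl⟩ : ∃ l : ℕ, q = l := ⟨q.natAbs, by omega⟩
      exact hpair m l (by omega) (by omega) (by omega) hlt
  · intro h t ht
    have hPM : ∀ i : ℕ, 1 ≤ i → i ≤ n → inPM n i := fun i h1 h2 => ⟨by omega, by omega, by omega⟩
    rcases t with i | ⟨i, j⟩ | ⟨i, j⟩
    · obtain ⟨h1, h2, h3⟩ := ht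
      have := h (-i) i (inPM_neg (hPM i h1 h2)) (hPM i h1 h2) (by omega)
      rw [z.sign_symm, y.sign_symm] at this
      exact ⟨h1, h2, by omega⟩
    · obtain ⟨h1, h2, h3, h4⟩ := ht
      exact ⟨h1, h2, h3, h i j (hPM i (by omega) (by omega)) (hPM j (by omega) (by omega))
        (by omega) h4⟩
    · obtain ⟨h1, h2, h3, h4⟩ := ht
      have := h (-i) j (inPM_neg (hPM i (by omega) (by omega))) (hPM j (by omega) (by omega))
        (by omega)
      rw [z.sign_symm, y.sign_symm] at this
      exact ⟨h1, h2, h3, by omega⟩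

theorem wle_iff_le (hz : (ctx α).H z) : wle z y ↔ (ctx α).le z y := by
  rw [wle_iff]
  constructor
  · exact fun h i j hi hj hb => h i j hi hj (lt_of_blockIdx_lt α hi hj hb)
  · intro h p q hp hq hpq hlt
    rcases (blockIdx_mono α hp hq hpq.le).eq_or_lt with he | hb
    · exact absurd ((hz p q hp hq he).2 hpq) (not_lt.2 hlt.le)
    · exact h p q hp hq hb hlt

theorem Inv_ssubset_iff (hz : (ctx α).H z) (hy : (ctx α).H y) :
    Inv z ⊂ Inv y ↔ (ctx α).le z y ∧ ¬ (ctx α).le y z := by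
  rw [← wle_iff_le hz, ← wle_iff_le hy]
  rfl

end Blocks

section Chain

variable {n : ℕ} (α : BComp n) {a b p q : ℤ}

/-- The primary key of the linear order on the labels. -/
def phase (a : ℤ) : ℤ :=
  if blockIdx α a = 0 then (if 0 < a then -3 else -1)
  else if blockIdx α a < 0 then -2 else blockIdx α a

/-- The linear order on the labels along which inversions are added. -/
def labelRank (t : ℤ × ℤ) : ℤ ×ₗ (ℤ ×ₗ ℤ) := toLex (phase α t.1, toLex (-t.1, t.2))

/-- The rank of the label representing an arbitrary pair. -/
def pairRank (p q : ℤ) : ℤ ×ₗ (ℤ ×ₗ ℤ) :=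
  if 0 ≤ p + q then labelRank α (p, q) else labelRank α (-q, -p)

theorem labelRank_le_iff {a' b' : ℤ} : labelRank α (a, b) ≤ labelRank α (a', b') ↔
    phase α a < phase α a' ∨ phase α a = phase α a' ∧ (a' < a ∨ a' = a ∧ b ≤ b') := by
  unfold labelRank
  simp only [Prod.Lex.toLex_le_toLex, neg_lt_neg_iff, neg_inj]
  constructor <;> rintro (h | ⟨h, h' | ⟨rfl, h'⟩⟩) <;> simp [*]

theorem labelRank_injective : Function.Injective (labelRank α) := by
  rintro ⟨a, b⟩ ⟨a', b'⟩ h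
  have h1 := (labelRank_le_iff α).1 h.le
  have h2 := (labelRank_le_iff α).1 h.ge
  ext <;> simp only <;> omega

variable {α}

theorem blockIdx_facts {x y : ℤ} (hx : inPM n x) (hy : inPM n y) :
    (blockIdx α x < blockIdx α y → x < y) ∧ (blockIdx α y < blockIdx α x → y < x) ∧
      (blockIdx α x + blockIdx α y < 0 → x + y < 0) ∧
      (0 < blockIdx α x + blockIdx α y → 0 < x + y) := by
  refine ⟨lt_of_blockIdx_lt α hx hy, lt_of_blockIdx_lt α hy hx, fun h => ?_, fun h => ?_⟩
  · have := lt_of_blockIdx_lt α hx (inPM_neg hy) (by rw [blockIdx_neg α hy.1]; omega)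
    omega
  · have := lt_of_blockIdx_lt α (inPM_neg hy) hx (by rw [blockIdx_neg α hy.1]; omega)
    omega

theorem pairRank_le (ha : inPM n a) (hb : inPM n b) (hab : 0 ≤ a + b) (hp : inPM n p)
    (hq : inPM n q) (h : (ctx α).K a b p q) : pairRank α p q ≤ labelRank α (a, b) := by
  have f1 := blockIdx_facts (α := α) ha hb
  have f2 := blockIdx_facts (α := α) ha hp
  have f3 := blockIdx_facts (α := α) ha hq
  have f4 := blockIdx_facts (α := α) hb hp
  have f5 := blockIdx_facts (α := α) hb hq
  have f6 := blockIdx_facts (α := α) hp hq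
  have ga := blockIdx_facts (α := α) ha ha
  have gb := blockIdx_facts (α := α) hb hb
  have gp := blockIdx_facts (α := α) hp hp
  have gq := blockIdx_facts (α := α) hq hq
  have a0 := ha.1
  have b0 := hb.1
  have p0 := hp.1
  have q0 := hq.1
  have nq := blockIdx_neg α q0
  simp only [Ctx.K, ctx] at h
  obtain ⟨h1, h2, h3⟩ := h
  unfold pairRank
  split_ifs with hs
  · rw [labelRank_le_iff]
    unfold phase
    rcases h1 with rfl | h1 <;> rcases h2 with rfl | h2 <;> split_ifs <;> omega
  · rw [labelRank_le_iff]
    unfold phase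
    rw [nq]
    rcases h1 with rfl | h1 <;> rcases h2 with rfl | h2 <;> split_ifs <;> omega

theorem le_pairRank (ha : inPM n a) (hb : inPM n b) (hab : 0 ≤ a + b) (hp : inPM n p)
    (hq : inPM n q) (h : (ctx α).dual.K a b p q) : labelRank α (a, b) ≤ pairRank α p q := by
  have f1 := blockIdx_facts (α := α) ha hb
  have f2 := blockIdx_facts (α := α) ha hp
  have f3 := blockIdx_facts (α := α) ha hq
  have f4 := blockIdx_facts (α := α) hb hp
  have f5 := blockIdx_facts (α := α) hb hq
  have f6 := blockIdx_facts (α := α) hp hq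
  have ga := blockIdx_facts (α := α) ha ha
  have gb := blockIdx_facts (α := α) hb hb
  have gp := blockIdx_facts (α := α) hp hp
  have gq := blockIdx_facts (α := α) hq hq
  have a0 := ha.1
  have b0 := hb.1
  have p0 := hp.1
  have q0 := hq.1
  have nq := blockIdx_neg α q0
  simp only [Ctx.K, Ctx.dual, ctx] at h
  obtain ⟨h1, h2, h3⟩ := h
  unfold pairRank
  split_ifs with hs
  · rw [labelRank_le_iff]
    unfold phase
    rcases h1 with rfl | h1 <;> rcases h2 with rfl | h2 <;> split_ifs <;> omega
  · rw [labelRank_le_iff]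
    unfold phase
    rw [nq]
    rcases h1 with rfl | h1 <;> rcases h2 with rfl | h2 <;> split_ifs <;> omega

variable (α) in
/-- The level of the positive element `p` in the chain element at the label `(a, b)`. -/
def level (a b p : ℤ) : ℤ :=
  if blockIdx α a = 0 ∧ 0 < a then
    (if blockIdx α p = 0 then (if p < a then 0 else if p = a then 2 else 4)
    else if p ≤ b then 1 else 3)
  else if blockIdx α a < 0 then
    (if blockIdx α p = 0 then 4 else if p < -a then -3 else if p = -a then -1
    else if p ≤ b then 0 else 2)
  else if blockIdx α a = 0 then
    (if blockIdx α p = 0 then (if p < -a then 0 else if p = -a then 2 else 4)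
    else if p ≤ b then -3 else -1)
  else if blockIdx α p = 0 then 0
  else if blockIdx α p < blockIdx α a then -blockIdx α p
  else if blockIdx α p = blockIdx α a then
    (if a < p then -blockIdx α a else if p = a then -blockIdx α a - 2 else -blockIdx α a - 4)
  else if p ≤ b then -blockIdx α a - 3 else -blockIdx α a - 1

variable (α) in
/-- The odd extension of `level`. -/
def signedLevel (a b p : ℤ) : ℤ := if 0 < p then level α a b p else -level α a b (-p)

theorem signedLevel_neg (hp : p ≠ 0) : signedLevel α a b (-p) = -signedLevel α a b p := by
  unfold signedLevel
  rcases lt_or_gt_of_ne hp with h | h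
  · rw [if_pos (show 0 < -p by omega), if_neg (show ¬ 0 < p by omega), neg_neg]
  · rw [if_neg (show ¬ 0 < -p by omega), if_pos h, neg_neg]

theorem level_mono (hpq : p < q) (h : blockIdx α p = blockIdx α q) :
    level α a b p ≤ level α a b q := by
  unfold level
  rw [h]
  split_ifs <;> omega

theorem level_nonneg (h : blockIdx α p = 0) : 0 ≤ level α a b p := by
  unfold level
  rw [h]
  split_ifs <;> omega

theorem signedLevel_mono (hp : inPM n p) (hq : inPM n q) (hpq : p < q)
    (h : blockIdx α p = blockIdx α q) : signedLevel α a b p ≤ signedLevel α a b q := by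
  have p0 := hp.1
  have q0 := hq.1
  have np := blockIdx_neg α p0
  have nq := blockIdx_neg α q0
  unfold signedLevel
  split_ifs with h1 h2 h2
  · exact level_mono hpq h
  · omega
  · have b1 := blockIdx_nonneg α h2
    have b2 := blockIdx_nonneg α (x := -p) (by omega)
    have := level_nonneg (α := α) (a := a) (b := b) (p := q) (by omega)
    have := level_nonneg (α := α) (a := a) (b := b) (p := -p) (by omega)
    omega
  · have := level_mono (α := α) (a := a) (b := b) (p := -q) (q := -p) (by omega) (by omega)
    omega

theorem level_lt_level_iff (ha : inPM n a) (hb : inPM n b) (hp : inPM n p) (hq : inPM n q)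
    (hab : blockIdx α a < blockIdx α b) (hpq : blockIdx α p < blockIdx α q) (hs : 0 ≤ a + b)
    (hp0 : 0 < p) : level α a b q < level α a b p ↔
      labelRank α (p, q) ≤ labelRank α (a, b) := by
  have f1 := blockIdx_facts (α := α) ha hb
  have f2 := blockIdx_facts (α := α) ha hp
  have f3 := blockIdx_facts (α := α) ha hq
  have f4 := blockIdx_facts (α := α) hb hp
  have f5 := blockIdx_facts (α := α) hb hq
  have f6 := blockIdx_facts (α := α) hp hq
  have ga := blockIdx_facts (α := α) ha ha
  have gb := blockIdx_facts (α := α) hb hb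
  have gp := blockIdx_facts (α := α) hp hp
  have gq := blockIdx_facts (α := α) hq hq
  have a0 := ha.1
  clear ha hb hp hq
  rw [labelRank_le_iff]
  unfold level
  rw [show phase α p = if blockIdx α p = 0 then -3 else blockIdx α p by
    unfold phase
    split_ifs <;> omega]
  unfold phase
  by_cases c1 : blockIdx α a = 0 ∧ 0 < a
  · rw [if_pos c1, if_pos c1, if_pos c1.1, if_pos c1.2]
    split_ifs <;> omega
  rw [if_neg c1, if_neg c1]
  by_cases c2 : blockIdx α a < 0
  · rw [if_pos c2, if_pos c2, if_neg c2.ne, if_pos c2]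
    split_ifs <;> omega
  rw [if_neg c2, if_neg c2]
  by_cases c3 : blockIdx α a = 0
  · rw [if_pos c3, if_pos c3, if_pos c3, if_neg (fun h => c1 ⟨c3, h⟩)]
    split_ifs <;> omega
  rw [if_neg c3, if_neg c3, if_neg c3, if_neg c2]
  split_ifs <;> omega

theorem level_lt_neg_level_iff (ha : inPM n a) (hb : inPM n b) (hp : inPM n p) (hq : inPM n q)
    (hab : blockIdx α a < blockIdx α b) (hpq : blockIdx α p < blockIdx α q) (hs : 0 ≤ a + b)
    (hs' : 0 ≤ p + q) (hp0 : p < 0) : level α a b q < -level α a b (-p) ↔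
      labelRank α (p, q) ≤ labelRank α (a, b) := by
  have np := blockIdx_neg α hp.1
  have f1 := blockIdx_facts (α := α) ha hb
  have f2 := blockIdx_facts (α := α) ha hp
  have f3 := blockIdx_facts (α := α) ha hq
  have f4 := blockIdx_facts (α := α) hb hp
  have f5 := blockIdx_facts (α := α) hb hq
  have f6 := blockIdx_facts (α := α) hp hq
  have ga := blockIdx_facts (α := α) ha ha
  have gb := blockIdx_facts (α := α) hb hb
  have gp := blockIdx_facts (α := α) hp hp
  have gq := blockIdx_facts (α := α) hq hq
  have a0 := ha.1
  clear ha hb hp hq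
  rw [labelRank_le_iff]
  unfold level
  rw [np, show phase α p = if blockIdx α p = 0 then -1 else -2 by
    unfold phase
    split_ifs <;> omega]
  unfold phase
  by_cases c1 : blockIdx α a = 0 ∧ 0 < a
  · rw [if_pos c1, if_pos c1, if_pos c1.1, if_pos c1.2]
    split_ifs <;> omega
  rw [if_neg c1, if_neg c1]
  by_cases c2 : blockIdx α a < 0
  · rw [if_pos c2, if_pos c2, if_neg c2.ne, if_pos c2]
    split_ifs <;> omega
  rw [if_neg c2, if_neg c2]
  by_cases c3 : blockIdx α a = 0
  · rw [if_pos c3, if_pos c3, if_pos c3, if_neg (fun h => c1 ⟨c3, h⟩)]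
    split_ifs <;> omega
  rw [if_neg c3, if_neg c3, if_neg c3, if_neg c2]
  split_ifs <;> omega

theorem signedLevel_lt_iff (hab : (a, b) ∈ (ctx α).labels) (hpq : (p, q) ∈ (ctx α).labels) :
    signedLevel α a b q < signedLevel α a b p ↔ labelRank α (p, q) ≤ labelRank α (a, b) := by
  obtain ⟨ha, hb, hlt, hs⟩ := Ctx.mem_labels.1 hab
  obtain ⟨hp, hq, hlt', hs'⟩ := Ctx.mem_labels.1 hpq
  have hpq' := lt_of_blockIdx_lt α hp hq hlt'
  have p0 := hp.1
  unfold signedLevel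
  rw [if_pos (show 0 < q by omega)]
  split_ifs with h
  · exact level_lt_level_iff ha hb hp hq hlt hlt' hs h
  · exact level_lt_neg_level_iff ha hb hp hq hlt hlt' hs hs' (by omega)

/-- The chain element at the label `(a, b)` inverts exactly the pairs up to `(a, b)`. -/
theorem exists_chain_element (hab : (a, b) ∈ (ctx α).labels) :
    ∃ x : SignedPerm n, (ctx α).H x ∧ ∀ p q, inPM n p → inPM n q →
      blockIdx α p < blockIdx α q →
      (x.perm q < x.perm p ↔ pairRank α p q ≤ labelRank α (a, b)) := by
  obtain ⟨x, hx⟩ := exists_sort_lex (n := n) (signedLevel α a b)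
    (fun p hp => signedLevel_neg hp.1)
  refine ⟨x, memH_iff.1 fun p q hp hq hpq hb => ?_, fun p q hp hq hb => ?_⟩
  · rw [hx p q hp hq]
    have := signedLevel_mono (a := a) (b := b) hp hq hpq hb
    omega
  · have hpq := lt_of_blockIdx_lt α hp hq hb
    rw [hx q p hq hp]
    unfold pairRank
    split_ifs with hs
    · rw [← signedLevel_lt_iff hab (Ctx.mem_labels.2 ⟨hp, hq, hb, hs⟩)]
      omega
    · rw [← signedLevel_lt_iff hab (Ctx.mem_labels.2 ⟨inPM_neg hq, inPM_neg hp,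
        by change blockIdx α (-q) < blockIdx α (-p)
           rw [blockIdx_neg α hq.1, blockIdx_neg α hp.1]; omega, by omega⟩),
        signedLevel_neg hp.1, signedLevel_neg hq.1]
      omega

/-- A family of elements deciding the labels one at a time. -/
theorem exists_chain (α : BComp n) :
    ∃ (c : Fin ((ctx α).labels.card + 1) → SignedPerm n)
      (t : Fin (ctx α).labels.card → ℤ × ℤ),
      Set.SurjOn t Set.univ (ctx α).labels ∧ (∀ j, t j ∈ (ctx α).labels) ∧
      (∀ i, (ctx α).H (c i)) ∧
      (∀ i j, j.castSucc < i → (ctx α).J (t j).1 (t j).2 (c i)) ∧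
      ∀ i j, i ≤ j.castSucc → (ctx α).M (t j).1 (t j).2 (c i) := by
  classical
  have hcard : ((ctx α).labels.image (labelRank α)).card = (ctx α).labels.card :=
    Finset.card_image_of_injective _ (labelRank_injective α)
  have hr : ∀ j : Fin (ctx α).labels.card, ∃ t ∈ (ctx α).labels, labelRank α t =
      ((ctx α).labels.image (labelRank α)).orderEmbOfFin hcard j :=
    fun j => Finset.mem_image.1 (Finset.orderEmbOfFin_mem _ hcard j)
  choose t ht hrt using hr
  choose x hxH hx using fun j => exists_chain_element (ht j)
  obtain ⟨e, he⟩ := exists_sort_lex (n := n) (fun _ => 0) (fun _ _ => rfl)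
  have heH : (ctx α).H e := fun i j hi hj _ => by
    rw [he i j hi hj]
    simp [ctx]
  have hM : ∀ (w : SignedPerm n) (s : ℤ × ℤ), s ∈ (ctx α).labels →
      (∀ p q, inPM n p → inPM n q → blockIdx α p < blockIdx α q →
        labelRank α s ≤ pairRank α p q → ¬ w.perm q < w.perm p) → (ctx α).M s.1 s.2 w := by
    intro w s hs h p q hp hq hK
    obtain ⟨ha, hb, -, hab⟩ := Ctx.mem_labels.1 hs
    have hlt : blockIdx α p < blockIdx α q := hK.2.2
    have h1 := h p q hp hq hlt (le_pairRank ha hb hab hp hq hK)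
    have h2 : w.perm p ≠ w.perm q := SignedPerm.perm_ne (by rintro rfl; exact lt_irrefl _ hlt)
    rw [negate_perm w hp, negate_perm w hq]
    omega
  refine ⟨Fin.cases e x, t, fun s hs => ?_, ht, fun i => ?_, fun i j hij => ?_, fun i j hij => ?_⟩
  · have : labelRank α s ∈ Set.range
        (((ctx α).labels.image (labelRank α)).orderEmbOfFin hcard) := by
      rw [Finset.range_orderEmbOfFin]
      exact Finset.mem_coe.2 (Finset.mem_image_of_mem _ hs)
    obtain ⟨j, hj⟩ := this
    exact ⟨j, trivial, labelRank_injective α ((hrt j).trans hj)⟩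
  · induction i using Fin.cases with
    | zero => exact heH
    | succ i => exact hxH i
  · induction i using Fin.cases with
    | zero => exact absurd hij (Fin.not_lt_zero _)
    | succ i =>
      intro p q hp hq hK
      obtain ⟨ha, hb, -, hab⟩ := Ctx.mem_labels.1 (ht j)
      refine (hx i p q hp hq hK.2.2).2 ((pairRank_le ha hb hab hp hq hK).trans ?_)
      change labelRank α (t j) ≤ labelRank α (t i)
      rw [hrt, hrt]
      exact (OrderEmbedding.le_iff_le _).2 (Fin.castSucc_lt_succ_iff.1 hij)
  · refine hM _ _ (ht j) fun p q hp hq hb hle => ?_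
    induction i using Fin.cases with
    | zero =>
      change ¬ e.perm q < e.perm p
      rw [he q p hq hp]
      have := lt_of_blockIdx_lt α hp hq hb
      omega
    | succ i =>
      change ¬ (x i).perm q < (x i).perm p
      rw [hx i p q hp hq hb, not_le]
      refine lt_of_lt_of_le ?_ hle
      change labelRank α (t i) < labelRank α (t j)
      rw [hrt, hrt]
      exact (OrderEmbedding.lt_iff_lt _).2 (Fin.succ_le_castSucc_iff.1 hij)

end Chain

section Translation

variable {n : ℕ} {α : BComp n} {x : SignedPerm n}

theorem mem_Tset : x ∈ Tset α ↔ (ctx α).T x := mem231_iff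

theorem isJoinIn_iff {y z u : SignedPerm n} (hy : (ctx α).T y) (hz : (ctx α).T z) :
    isJoinIn (Tset α) y z u ↔ (ctx α).IsJoin y z u := by
  simp only [isJoinIn, Ctx.IsJoin, mem_Tset, wle_iff_le hy.1,
    wle_iff_le hz.1]
  exact and_congr_right fun hu => by simp only [wle_iff_le hu.1]

theorem isMeetIn_iff {y z m : SignedPerm n} :
    isMeetIn (Tset α) y z m ↔ (ctx α).IsMeet y z m := by
  simp only [isMeetIn, Ctx.IsMeet, mem_Tset]
  refine and_congr_right fun hm => ?_
  rw [wle_iff_le hm.1, wle_iff_le hm.1]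
  refine and_congr_right fun _ => and_congr_right fun _ => forall₂_congr fun w hw => ?_
  rw [wle_iff_le hw.1, wle_iff_le hw.1, wle_iff_le hw.1]

theorem joinIrred_iff : joinIrred α x ↔ IsIrr (ctx α).le (ctx α).T x := by
  simp only [joinIrred, IsIrr, mem_Tset]
  refine and_congr_right fun hx => and_congr (not_congr (forall₂_congr fun y _ => ?_))
    (forall₂_congr fun y z => ⟨fun h hy hz h1 h2 h3 => ?_, fun h hy hz hj => ?_⟩)
  · rw [wle_iff_le hx.1]
  · exact h hy hz ((isJoinIn_iff hy hz).2 ⟨hx, h1, h2, h3⟩)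
  · obtain ⟨-, h1, h2, h3⟩ := (isJoinIn_iff hy hz).1 hj
    exact h hy hz h1 h2 h3

theorem meetIrred_iff : meetIrred α x ↔ IsIrr (flip (ctx α).le) (ctx α).T x := by
  simp only [meetIrred, IsIrr, mem_Tset, flip]
  refine and_congr_right fun hx => and_congr (not_congr (forall₂_congr fun y hy => ?_))
    (forall₂_congr fun y z => ⟨fun h hy hz h1 h2 h3 => ?_, fun h hy hz hj => ?_⟩)
  · rw [wle_iff_le hy.1]
  · exact h hy hz (isMeetIn_iff.2 ⟨hx, h1, h2, h3⟩)
  · obtain ⟨-, h1, h2, h3⟩ := isMeetIn_iff.1 hj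
    exact h hy hz h1 h2 h3

theorem leftModular_of_forall (hH : (ctx α).H x)
    (h : ∀ t ∈ (ctx α).labels, (ctx α).J t.1 t.2 x ∨ (ctx α).M t.1 t.2 x) :
    leftModular (Tset α) x := by
  intro r q hr hq hrq u v w₁ w₂ hu hv hw₁ hw₂
  have hr' := mem231_iff.1 hr
  have hx := Ctx.T_of_forall hH h
  have hw₁' := isMeetIn_iff.1 hw₁
  exact Ctx.left_modular hH h hr' (mem231_iff.1 hq) ((wle_iff_le hr'.1).1 hrq)
    ((isJoinIn_iff hr' hx).1 hu) (isMeetIn_iff.1 hv) hw₁' ((isJoinIn_iff hr' hw₁'.1).1 hw₂)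

end Translation

/-- For every type-B composition `α` of `n`, the lattice
`Tam_B(α)` is trim: the number of join-irreducible elements, the number of
meet-irreducible elements, and the length `L` all coincide, and there is a
chain of `L+1` left-modular elements. -/
theorem tamB_trim (n : ℕ) (hn : 1 ≤ n) (α : BComp n) :
    ∃ L : ℕ, IsGreatest (chainLengths (Tset α)) L ∧
      {x : SignedPerm n | joinIrred α x}.ncard = L ∧
      {x : SignedPerm n | meetIrred α x}.ncard = L ∧
      ∃ c : Fin (L + 1) → SignedPerm n,
        (∀ i, c i ∈ Tset α) ∧
        (∀ i j : Fin (L + 1), i < j → Inv (c i) ⊂ Inv (c j)) ∧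
        (∀ i, leftModular (Tset α) (c i)) := by
  obtain ⟨c, t, ht, ht', hH, hJ, hM⟩ := exists_chain α
  obtain ⟨hT, hlt, hji, hmi, hdec⟩ := Ctx.trim_of_chain c t ht ht' hH hJ hM
  have hc : ∀ i, c i ∈ Tset α := fun i => mem231_iff.2 (hT i)
  have hlt' : ∀ i j : Fin ((ctx α).labels.card + 1), i < j → Inv (c i) ⊂ Inv (c j) :=
    fun i j hij => (Inv_ssubset_iff (hH i) (hH j)).2 (hlt i j hij)
  simp only [joinIrred_iff, meetIrred_iff]
  refine ⟨_, ⟨⟨c, hc, hlt'⟩, ?_⟩, hji, hmi, c, hc, hlt',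
    fun i => leftModular_of_forall (hH i) (hdec i)⟩
  rintro m ⟨f, hf, hf'⟩
  have hf'' : ∀ i, (ctx α).T (f i) := fun i => mem231_iff.1 (hf i)
  exact Ctx.chain_le f hf'' fun i j hij =>
    (Inv_ssubset_iff (hf'' i).1 (hf'' j).1).1 (hf' i j hij)

end TypeB
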